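/- arXiv:math/9503211 — 2 statements merged into one kernel-verified Lean document; each statement's English description precedes it below -/
import Mathlib

section
/- Suppose Y is a Banach lattice which is r-convex for some r > 2 and q-concave for some q < ∞, and suppose X is a Banach lattice which is p-convex for some p > 2 and isomorphic as a Banach space to a closed subspace of Y. Then X is r-convex. (Theorem 4.2) -/
/-!
Common definitions for formalizing results of Hernandez–Kalton,
"Subspaces of rearrangement-invariant spaces".

We model (quasi-)Köthe function spaces on a measure space `(α, μ)` by their
(possibly infinite-valued) admissible function quasinorm `N`, defined on all
functions `α → ℝ`, together with the usual axioms (a.e.-invariance, homogeneity,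
solidity, a `p`-norm inequality for some `0 < p ≤ 1`, nondegeneracy and
completeness).  Rearrangement-invariant spaces on `[0,1]` or `[0,∞)` are such
spaces for Lebesgue measure restricted to the relevant interval, whose norm is
invariant under equimeasurability and normalized on `χ_{[0,1]}`.  Nonatomic
Polish measure spaces such as the Cantor group `(Δ, λ)` are modelled by
`([0,1), Lebesgue)`, to which they are measure-isomorphic.  Abstract (separable,
order-continuous) Banach lattices are modelled by their Köthe function space
representations.
-/

open MeasureTheory Filter Set ENNReal

noncomputable section
namespace RIPaper

/-- The interval `[0,1)`, a measure-theoretic model of `[0,1]`. -/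
abbrev I01 : Set ℝ := Set.Ico (0:ℝ) 1

/-- The half-line `[0,∞)`. -/
abbrev Iinf : Set ℝ := Set.Ici (0:ℝ)

/-- Lebesgue measure restricted to `I`. -/
abbrev μint (I : Set ℝ) : Measure ℝ := volume.restrict I

/-- Lebesgue measure on `[0,1)`; a model of the Cantor group `(Δ, λ)`. -/
abbrev μ01 : Measure ℝ := μint I01

/-- A quasi-Köthe function space on `(α, μ)`, given by its admissible function
`p`-norm (`0 < p ≤ 1`), extended by `∞` off the space itself. -/
structure QuasiKothe (α : Type*) [MeasurableSpace α] (μ : Measure α) where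
  N : (α → ℝ) → ℝ≥0∞
  ae_congr : ∀ {f g : α → ℝ}, f =ᵐ[μ] g → N f = N g
  smul_eq : ∀ (c : ℝ) (f : α → ℝ), N (fun t => c * f t) = ENNReal.ofReal |c| * N f
  solid : ∀ {f g : α → ℝ}, (∀ᵐ t ∂μ, |f t| ≤ |g t|) → N f ≤ N g
  p : ℝ
  p_pos : 0 < p
  p_le_one : p ≤ 1
  pnorm : ∀ f g : α → ℝ, N (f + g) ^ p ≤ N f ^ p + N g ^ p
  eq_zero : ∀ {f : α → ℝ}, Measurable f → N f = 0 → f =ᵐ[μ] 0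
  complete : ∀ f : ℕ → α → ℝ, (∀ n, N (f n) < ⊤) →
      (∑' n, N (f (n+1) - f n) ^ p) < ⊤ →
      ∃ g : α → ℝ, Tendsto (fun n => N (f n - g)) atTop (nhds 0)

variable {α β : Type*} [MeasurableSpace α] [MeasurableSpace β]

/-- The space is a Banach (i.e. normed, `1`-convex) Köthe function space. -/
def Banach {μ : Measure α} (X : QuasiKothe α μ) : Prop :=
  ∀ f g : α → ℝ, X.N (f + g) ≤ X.N f + X.N g

/-- `p`-convexity with constant `C`. -/
def PConvexC (N : (α → ℝ) → ℝ≥0∞) (p : ℝ) (C : ℝ≥0∞) : Prop :=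
  ∀ (n : ℕ) (f : Fin n → α → ℝ),
    N (fun t => (∑ i, |f i t| ^ p) ^ p⁻¹) ≤ C * (∑ i, N (f i) ^ p) ^ p⁻¹

/-- `p`-convexity (`0 < p < ∞`). -/
def PConvex (N : (α → ℝ) → ℝ≥0∞) (p : ℝ) : Prop :=
  ∃ C : ℝ≥0∞, C ≠ ⊤ ∧ PConvexC N p C

/-- `q`-concavity with constant `c` (i.e. `c • (∑ ‖fᵢ‖^q)^{1/q} ≤ ‖(∑ |fᵢ|^q)^{1/q}‖`). -/
def QConcaveC (N : (α → ℝ) → ℝ≥0∞) (q : ℝ) (c : ℝ≥0∞) : Prop :=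
  ∀ (n : ℕ) (f : Fin n → α → ℝ),
    c * (∑ i, N (f i) ^ q) ^ q⁻¹ ≤ N (fun t => (∑ i, |f i t| ^ q) ^ q⁻¹)

/-- `q`-concavity (`0 < q < ∞`). -/
def QConcave (N : (α → ℝ) → ℝ≥0∞) (q : ℝ) : Prop :=
  ∃ c : ℝ≥0∞, 0 < c ∧ QConcaveC N q c

/-- Strict `2`-convexity: `r`-convexity for some `r > 2`. -/
def Strictly2Convex (N : (α → ℝ) → ℝ≥0∞) : Prop := ∃ r : ℝ, 2 < r ∧ PConvex N r

/-- Strict `2`-concavity: `s`-concavity for some `s < 2`. -/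
def Strictly2Concave (N : (α → ℝ) → ℝ≥0∞) : Prop := ∃ s : ℝ, 0 < s ∧ s < 2 ∧ QConcave N s

/-- Nontrivial concavity: `q`-concavity for some `q < ∞`. -/
def NontrivialConcavity (N : (α → ℝ) → ℝ≥0∞) : Prop := ∃ q : ℝ, 0 < q ∧ QConcave N q

/-- The decreasing rearrangement of `f` with respect to the measure `m`. -/
def rearr (m : Measure α) (f : α → ℝ) (t : ℝ) : ℝ :=
  sInf {x : ℝ | 0 ≤ x ∧ m {s | x < |f s|} ≤ ENNReal.ofReal t}

/-- `f` (on `(α,m)`) and `g` (on `(β,m')`) have the same distribution. -/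
def EquiDistrib (m : Measure α) (m' : Measure β) (f : α → ℝ) (g : β → ℝ) : Prop :=
  ∀ x : ℝ, 0 < x → m {t | x < |f t|} = m' {t | x < |g t|}

/-- `N` is a rearrangement-invariant function norm on the interval `I` with
`‖χ_{[0,1]}‖ = 1`. -/
def RI (I : Set ℝ) (N : (ℝ → ℝ) → ℝ≥0∞) : Prop :=
  (∀ f g : ℝ → ℝ, Measurable f → Measurable g →
      EquiDistrib (μint I) (μint I) f g → N f = N g) ∧
    N (Set.indicator I01 (fun _ => (1:ℝ))) = 1

/-- The space with function norm `NX` is isomorphic, as a (quasi-)Banach space, to a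
closed subspace of the space with function norm `NY`. -/
def Embeds (NX : (α → ℝ) → ℝ≥0∞) (NY : (β → ℝ) → ℝ≥0∞) : Prop :=
  ∃ T : (α → ℝ) →ₗ[ℝ] (β → ℝ), ∃ c C : ℝ≥0∞, 0 < c ∧ C ≠ ⊤ ∧
    ∀ f : α → ℝ, NX f ≠ ⊤ → c * NX f ≤ NY (T f) ∧ NY (T f) ≤ C * NX f

/-- The space with function norm `NX` is lattice-isomorphic to a closed sublattice of the
space with function norm `NY` (over the measure `ν`). -/
def LatticeEmbeds (NX : (α → ℝ) → ℝ≥0∞) (ν : Measure β) (NY : (β → ℝ) → ℝ≥0∞) : Prop :=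
  ∃ T : (α → ℝ) →ₗ[ℝ] (β → ℝ),
    (∃ c C : ℝ≥0∞, 0 < c ∧ C ≠ ⊤ ∧
      ∀ f : α → ℝ, NX f ≠ ⊤ → c * NX f ≤ NY (T f) ∧ NY (T f) ≤ C * NX f) ∧
    ∀ f g : α → ℝ, NX f ≠ ⊤ → NX g ≠ ⊤ → T (f ⊔ g) =ᵐ[ν] (T f ⊔ T g)

/-- A cone-embedding of the space with norm `NX` (on `(α,μ)`) into the space with
norm `NY` (on `(β,ν)`): a bounded positive operator with a lower bound on the cone. -/
def ConeEmbeds (μ : Measure α) (NX : (α → ℝ) → ℝ≥0∞)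
    (ν : Measure β) (NY : (β → ℝ) → ℝ≥0∞) : Prop :=
  ∃ L : (α → ℝ) →ₗ[ℝ] (β → ℝ),
    (∀ f : α → ℝ, (∀ᵐ t ∂μ, 0 ≤ f t) → ∀ᵐ t ∂ν, 0 ≤ L f t) ∧
    (∃ C : ℝ≥0∞, C ≠ ⊤ ∧ ∀ f : α → ℝ, NY (L f) ≤ C * NX f) ∧
    (∃ δ : ℝ≥0∞, 0 < δ ∧ ∀ f : α → ℝ, (∀ᵐ t ∂μ, 0 ≤ f t) → δ * NX f ≤ NY (L f))

/-- A strong cone-embedding: a cone-embedding which moreover satisfies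
`‖max xₖ‖_X ≤ C ‖max L xₖ‖_Y` for finitely many `xₖ ≥ 0`. -/
def StrongConeEmbeds (μ : Measure α) (NX : (α → ℝ) → ℝ≥0∞)
    (ν : Measure β) (NY : (β → ℝ) → ℝ≥0∞) : Prop :=
  ∃ L : (α → ℝ) →ₗ[ℝ] (β → ℝ),
    (∀ f : α → ℝ, (∀ᵐ t ∂μ, 0 ≤ f t) → ∀ᵐ t ∂ν, 0 ≤ L f t) ∧
    (∃ C : ℝ≥0∞, C ≠ ⊤ ∧ ∀ f : α → ℝ, NY (L f) ≤ C * NX f) ∧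
    (∃ δ : ℝ≥0∞, 0 < δ ∧ ∀ f : α → ℝ, (∀ᵐ t ∂μ, 0 ≤ f t) → δ * NX f ≤ NY (L f)) ∧
    (∃ C' : ℝ≥0∞, C' ≠ ⊤ ∧ ∀ (n : ℕ) (x : Fin (n+1) → α → ℝ),
      (∀ i, ∀ᵐ t ∂μ, 0 ≤ x i t) →
      NX (fun t => ⨆ i, x i t) ≤ C' * NY (fun t => ⨆ i, L (x i) t))

/-- The `p`-concavification `X_{1/p}` of the space with norm `N`:
`‖f‖_{X_{1/p}} = ‖ |f|^{1/p} ‖_X ^ p`.  (`p = 2` gives the `2`-concavification `X_{1/2}`.) -/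
def concavify (N : (α → ℝ) → ℝ≥0∞) (p : ℝ) : (α → ℝ) → ℝ≥0∞ :=
  fun f => N (fun t => |f t| ^ p⁻¹) ^ p

/-- The `L_p`-norm on `(α, m)` (`0 < p < ∞`). -/
def LpN (m : Measure α) (p : ℝ) : (α → ℝ) → ℝ≥0∞ := fun f => eLpNorm f (ENNReal.ofReal p) m

/-- The two function spaces coincide, with equivalent norms. -/
def EquivNorms (N1 N2 : (α → ℝ) → ℝ≥0∞) : Prop :=
  ∃ c C : ℝ≥0∞, 0 < c ∧ C ≠ ⊤ ∧ ∀ f : α → ℝ, c * N2 f ≤ N1 f ∧ N1 f ≤ C * N2 f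

/-- The two function spaces on `ℝ` coincide, with equivalent norms, on functions supported
on `[0,1]`; expresses statements like `Y[0,1] = L_p[0,1]`. -/
def EquivNormsOn01 (N1 N2 : (ℝ → ℝ) → ℝ≥0∞) : Prop :=
  ∃ c C : ℝ≥0∞, 0 < c ∧ C ≠ ⊤ ∧ ∀ f : ℝ → ℝ, (∀ t, t ∉ I01 → f t = 0) →
    c * N2 f ≤ N1 f ∧ N1 f ≤ C * N2 f

/-- The norm of the r.i. space `Y_f`: `‖y‖_{Y_f} = ‖y ⊗ f‖_{Y(I×I)}`, computed via the
decreasing rearrangement of `y ⊗ f` over the product measure space. -/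
def YfN (I : Set ℝ) (NY : (ℝ → ℝ) → ℝ≥0∞) (f : ℝ → ℝ) : (ℝ → ℝ) → ℝ≥0∞ :=
  fun y => NY (rearr ((μint I).prod (μint I)) (fun q : ℝ × ℝ => y q.1 * f q.2))

/-- The operator norm of the dilation operator `D_s f (t) = f (t/s)`. -/
def dilNorm (NY : (ℝ → ℝ) → ℝ≥0∞) (s : ℝ) : ℝ≥0∞ :=
  ⨆ f : {f : ℝ → ℝ // NY f ≤ 1}, NY (fun t => f.1 (t / s))

/-- The lower Boyd index `p_Y = lim_{s→∞} (log s)/(log ‖D_s‖)` (stated as a `liminf`;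
for r.i. spaces the limit exists by submultiplicativity of `s ↦ ‖D_s‖`). -/
def lowerBoyd (NY : (ℝ → ℝ) → ℝ≥0∞) : ℝ :=
  liminf (fun s : ℝ => Real.log s / Real.log (dilNorm NY s).toReal) atTop

/-- An Orlicz function. -/
structure OrliczFun where
  F : ℝ → ℝ
  zero : F 0 = 0
  mono : MonotoneOn F (Set.Ici 0)
  convex : ConvexOn ℝ (Set.Ici 0) F
  pos : ∀ t : ℝ, 0 < t → 0 < F t
  cont : ContinuousOn F (Set.Ici 0)

/-- `e_n = χ_{[2^n, 2^{n+1})}`. -/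
def en (n : ℤ) : ℝ → ℝ := Set.indicator (Set.Ico ((2:ℝ)^n) ((2:ℝ)^(n+1))) (fun _ => 1)

/-- The Luxemburg norm of the modular sequence space `ℓ_{(F_n)}`. -/
def modN (F : ℤ → OrliczFun) (a : ℤ →₀ ℝ) : ℝ :=
  sInf {ρ : ℝ | 0 < ρ ∧ ∑ n ∈ a.support, (F n).F (|a n| / ρ) ≤ 1}

/-- The index set of the sequence `e_n` spanning `E_Y`: the negative integers if `Y` is an
r.i. space on `[0,1]`, and all of `ℤ` if `Y` is an r.i. space on `[0,∞)`. -/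
def EIndex (I : Set ℝ) : Set ℤ := {n : ℤ | I = I01 → n < 0}

/-- `Y` (an r.i. space on `I`) is of Orlicz–Lorentz type: `E_Y` is naturally isomorphic to a
modular sequence space `ℓ_{(F_n)}`. -/
def OrliczLorentzType (I : Set ℝ) (NY : (ℝ → ℝ) → ℝ≥0∞) : Prop :=
  ∃ F : ℤ → OrliczFun, ∃ c C : ℝ, 0 < c ∧ 0 < C ∧
    ∀ a : ℤ →₀ ℝ, (↑a.support : Set ℤ) ⊆ EIndex I →
      ENNReal.ofReal (c * modN F a) ≤ NY (fun t => ∑ n ∈ a.support, a n * en n t) ∧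
      NY (fun t => ∑ n ∈ a.support, a n * en n t) ≤ ENNReal.ofReal (C * modN F a)

/-- Membership in the linear span of the functions `e_n`, `n ∈ ℤ` (dense in `E_Y`). -/
def InSpanE (g : ℝ → ℝ) : Prop :=
  ∃ b : ℤ →₀ ℝ, g = fun t => ∑ n ∈ b.support, b n * en n t

/-- The (basic) sequence `x` of the space with norm `NX` is lattice finitely representable
in `E_Y`: finitely many `x i` at a time are `(1+ε)`-equivalent, preserving the lattice
structure (via disjointness of supports), to a disjoint sequence in the span of the `e_n`. -/
def SeqLatFinRepInE {ι : Type*} (NX : (α → ℝ) → ℝ≥0∞) (x : ι → α → ℝ)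
    (NY : (ℝ → ℝ) → ℝ≥0∞) : Prop :=
  ∀ (s : Finset ι) (ε : ℝ), 0 < ε → ∃ g : ι → ℝ → ℝ,
    (∀ i ∈ s, InSpanE (g i)) ∧
    (∀ i ∈ s, ∀ j ∈ s, i ≠ j → ∀ t, g i t * g j t = 0) ∧
    ∀ a : ι → ℝ,
      NY (fun t => ∑ i ∈ s, a i * g i t) ≤
          ENNReal.ofReal (1+ε) * NX (fun t => ∑ i ∈ s, a i * x i t) ∧
      NX (fun t => ∑ i ∈ s, a i * x i t) ≤
          ENNReal.ofReal (1+ε) * NY (fun t => ∑ i ∈ s, a i * g i t)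

/-- The Haar function `h_{n,k}` on `[k 2^{-n}, (k+1) 2^{-n})`. -/
def haarNK (n k : ℕ) : ℝ → ℝ := fun t =>
  if (k : ℝ) / 2^n ≤ t ∧ t < ((k : ℝ) + 1/2) / 2^n then 1
  else if ((k : ℝ) + 1/2) / 2^n ≤ t ∧ t < ((k : ℝ) + 1) / 2^n then -1 else 0

/-- Index type for the Haar system on `[0,1]`. -/
def HaarIdx : Type := Option ((n : ℕ) × Fin (2^n))

/-- The Haar system on `[0,1]`. -/
def haarSys : HaarIdx → ℝ → ℝ
  | none => Set.indicator I01 (fun _ => 1)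
  | some ⟨n, k⟩ => haarNK n k.val

/-- The (nonatomic) Banach lattice with function norm `NZ` over `(α, m)` is lattice finitely
representable in the space with norm `NX` over `(β, m')`: every finite-dimensional sublattice
(equivalently, the span of finitely many disjoint positive elements) of the former is
`(1+ε)`-lattice-isomorphic to a sublattice of the latter, for every `ε > 0`. -/
def LatFinRep (m : Measure α) (NZ : (α → ℝ) → ℝ≥0∞)
    (m' : Measure β) (NX : (β → ℝ) → ℝ≥0∞) : Prop :=
  ∀ (n : ℕ) (z : Fin n → α → ℝ),
    (∀ i, ∀ᵐ t ∂m, 0 ≤ z i t) → (∀ i j, i ≠ j → ∀ᵐ t ∂m, z i t * z j t = 0) →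
    ∀ ε : ℝ, 0 < ε →
    ∃ x : Fin n → β → ℝ, (∀ i, ∀ᵐ t ∂m', 0 ≤ x i t) ∧ (∀ i, NX (x i) ≠ ⊤) ∧
      (∀ i j, i ≠ j → ∀ᵐ t ∂m', x i t * x j t = 0) ∧
      ∀ a : Fin n → ℝ,
        NX (fun t => ∑ i, a i * x i t) ≤
            ENNReal.ofReal (1+ε) * NZ (fun t => ∑ i, a i * z i t) ∧
        NZ (fun t => ∑ i, a i * z i t) ≤
            ENNReal.ofReal (1+ε) * NX (fun t => ∑ i, a i * x i t)

/-- `u` is an unconditional basis of the space with function norm `N`. -/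
def UncondBasis (N : (α → ℝ) → ℝ≥0∞) (u : ℕ → α → ℝ) : Prop :=
  (∀ n, N (u n) ≠ 0 ∧ N (u n) ≠ ⊤) ∧
  (∀ a : ℕ →₀ ℝ, N (fun t => ∑ n ∈ a.support, a n * u n t) = 0 → a = 0) ∧
  (∃ K : ℝ≥0∞, K ≠ ⊤ ∧ ∀ (a : ℕ →₀ ℝ) (ε : ℕ → ℝ), (∀ n, |ε n| ≤ 1) →
    N (fun t => ∑ n ∈ a.support, ε n * a n * u n t) ≤
      K * N (fun t => ∑ n ∈ a.support, a n * u n t)) ∧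
  (∀ f : α → ℝ, N f ≠ ⊤ → ∀ η : ℝ≥0∞, 0 < η →
    ∃ a : ℕ →₀ ℝ, N (fun t => f t - ∑ n ∈ a.support, a n * u n t) < η)

/-- A good Köthe function space on `(Δ, λ)` (modelled on `([0,1), Lebesgue)`):
`L_∞ ⊆ X ⊆ L_1` with `‖f‖_1 ≤ ‖f‖_X ≤ 2 ‖f‖_∞`. -/
def Good (X : QuasiKothe ℝ μ01) : Prop :=
  Banach X ∧ (∀ f : ℝ → ℝ, eLpNorm f 1 μ01 ≤ X.N f) ∧
    ∀ f : ℝ → ℝ, X.N f ≤ 2 * eLpNorm f ⊤ μ01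

/-- Order continuity: every order-bounded increasing sequence is norm convergent. -/
def OrderCont (μ : Measure α) (N : (α → ℝ) → ℝ≥0∞) : Prop :=
  ∀ (f : ℕ → α → ℝ) (b : α → ℝ), (∀ n, N (f n) ≠ ⊤) → N b ≠ ⊤ →
    (∀ n, ∀ᵐ t ∂μ, f n t ≤ f (n+1) t) → (∀ n, ∀ᵐ t ∂μ, f n t ≤ b t) →
    ∃ g : α → ℝ, Tendsto (fun n => N (fun t => f n t - g t)) atTop (nhds 0)

/-- `f** (t) = t⁻¹ ∫₀ᵗ f*(s) ds`. -/
def starstar (m : Measure α) (f : α → ℝ) (t : ℝ) : ℝ :=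
  (∫ s in Set.Ioc (0:ℝ) t, rearr m f s) / t

/-- Property (d): `g** ≤ f**` and `f ∈ X` imply `g ∈ X` with `‖g‖ ≤ C ‖f‖`. -/
def PropertyD (m : Measure α) (N : (α → ℝ) → ℝ≥0∞) : Prop :=
  ∃ C : ℝ≥0∞, C ≠ ⊤ ∧ ∀ f g : α → ℝ, Measurable f → Measurable g → N f ≠ ⊤ →
    (∀ t : ℝ, 0 < t → starstar m g t ≤ starstar m f t) → N g ≤ C * N f

/-- Separability of the function space with norm `N`. -/
def SeparableFS (N : (α → ℝ) → ℝ≥0∞) : Prop :=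
  ∃ D : Set (α → ℝ), D.Countable ∧
    ∀ f : α → ℝ, N f ≠ ⊤ → ∀ ε : ℝ≥0∞, 0 < ε → ∃ g ∈ D, N (f - g) < ε

/-- Nonatomicity of the underlying measure; for a Köthe function space this is
equivalent to nonatomicity of the Banach lattice. -/
def NonatomicMeasure (m : Measure α) : Prop :=
  ∀ s : Set α, MeasurableSet s → m s ≠ 0 →
    ∃ t : Set α, MeasurableSet t ∧ t ⊆ s ∧ m t ≠ 0 ∧ m t ≠ m s

/-- The space with norm `NX` is isomorphic to a complemented closed subspace of the space
with norm `NY` (over the measure `ν`). -/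
def ComplementablyEmbeds (NX : (α → ℝ) → ℝ≥0∞) (ν : Measure β)
    (NY : (β → ℝ) → ℝ≥0∞) : Prop :=
  ∃ T : (α → ℝ) →ₗ[ℝ] (β → ℝ),
    (∃ c C : ℝ≥0∞, 0 < c ∧ C ≠ ⊤ ∧
      ∀ f : α → ℝ, NX f ≠ ⊤ → c * NX f ≤ NY (T f) ∧ NY (T f) ≤ C * NX f) ∧
    ∃ P : (β → ℝ) →ₗ[ℝ] (β → ℝ),
      (∃ K : ℝ≥0∞, K ≠ ⊤ ∧ ∀ g : β → ℝ, NY (P g) ≤ K * NY g) ∧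
      (∀ f : α → ℝ, NX f ≠ ⊤ → P (T f) =ᵐ[ν] T f) ∧
      (∀ g : β → ℝ, NY g ≠ ⊤ → ∃ f : α → ℝ, NX f ≠ ⊤ ∧ P g =ᵐ[ν] T f)

/-- The space with norm `NX` is lattice-isomorphic to a complemented sublattice of the
space with norm `NY` (over the measure `ν`). -/
def LatticeComplementablyEmbeds (NX : (α → ℝ) → ℝ≥0∞) (ν : Measure β)
    (NY : (β → ℝ) → ℝ≥0∞) : Prop :=
  ∃ T : (α → ℝ) →ₗ[ℝ] (β → ℝ),
    (∃ c C : ℝ≥0∞, 0 < c ∧ C ≠ ⊤ ∧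
      ∀ f : α → ℝ, NX f ≠ ⊤ → c * NX f ≤ NY (T f) ∧ NY (T f) ≤ C * NX f) ∧
    (∀ f g : α → ℝ, NX f ≠ ⊤ → NX g ≠ ⊤ → T (f ⊔ g) =ᵐ[ν] (T f ⊔ T g)) ∧
    ∃ P : (β → ℝ) →ₗ[ℝ] (β → ℝ),
      (∃ K : ℝ≥0∞, K ≠ ⊤ ∧ ∀ g : β → ℝ, NY (P g) ≤ K * NY g) ∧
      (∀ f : α → ℝ, NX f ≠ ⊤ → P (T f) =ᵐ[ν] T f) ∧
      (∀ g : β → ℝ, NY g ≠ ⊤ → ∃ f : α → ℝ, NX f ≠ ⊤ ∧ P g =ᵐ[ν] T f)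

/-- The space with norm `NY` (over `(β,ν)`) contains a complemented sublattice
lattice-isomorphic to `ℓ₂`, i.e. a complemented disjoint positive sequence equivalent to
the unit vector basis of `ℓ₂`. -/
def HasComplementedL2Lattice (ν : Measure β) (NY : (β → ℝ) → ℝ≥0∞) : Prop :=
  ∃ y : ℕ → β → ℝ,
    (∀ n, ∀ᵐ t ∂ν, 0 ≤ y n t) ∧
    (∀ n k, n ≠ k → ∀ᵐ t ∂ν, y n t * y k t = 0) ∧
    (∃ c C : ℝ≥0∞, 0 < c ∧ C ≠ ⊤ ∧ ∀ a : ℕ →₀ ℝ,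
      c * ENNReal.ofReal (Real.sqrt (∑ n ∈ a.support, (a n)^2)) ≤
          NY (fun t => ∑ n ∈ a.support, a n * y n t) ∧
      NY (fun t => ∑ n ∈ a.support, a n * y n t) ≤
          C * ENNReal.ofReal (Real.sqrt (∑ n ∈ a.support, (a n)^2))) ∧
    ∃ P : (β → ℝ) →ₗ[ℝ] (β → ℝ),
      (∃ K : ℝ≥0∞, K ≠ ⊤ ∧ ∀ g : β → ℝ, NY (P g) ≤ K * NY g) ∧
      (∀ n, P (y n) =ᵐ[ν] y n) ∧
      (∀ g : β → ℝ, NY g ≠ ⊤ → ∀ ε : ℝ≥0∞, 0 < ε → ∃ a : ℕ →₀ ℝ,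
        NY (fun t => P g t - ∑ n ∈ a.support, a n * y n t) < ε)

end RIPaper

namespace RIPaper

def sg : Bool → ℝ := fun b => if b then 1 else -1

def xi {m : ℕ} (i : Fin m) (z : Fin m × Bool) : ℝ := if z.1 = i then sg z.2 else 0

lemma expsum_le {J : Type*} [Fintype J] [DecidableEq J] {m : ℕ} (i : Fin m) (x : J → ℝ)
    (hx : ∀ j, |x j| ≤ 1) (hs : ∑ j, x j ^ 2 ≤ m) :
    ∑ ω : J → Fin m × Bool, Real.exp (∑ j, xi i (ω j) * x j)
      ≤ Fintype.card (J → Fin m × Bool) * Real.exp 1 := by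
  have hm : (0:ℝ) < m := by exact_mod_cast i.pos
  simp_rw [Real.exp_sum]
  rw [← Fintype.prod_sum (fun (j : J) (z : Fin m × Bool) => Real.exp (xi i z * x j))]
  have h1 : ∀ j, ∑ z : Fin m × Bool, Real.exp (xi i z * x j) ≤ (2 * m) * Real.exp (x j ^ 2 / m) := by
    intro j
    rw [Fintype.sum_prod_type]
    have h2 : ∀ k : Fin m, ∑ b : Bool, Real.exp (xi i (k, b) * x j)
        ≤ 2 + (if k = i then 2 * x j ^ 2 else 0) := by
      intro k
      by_cases hk : k = i
      · simp only [xi, hk, sg, Fintype.sum_bool, if_true]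
        have := (abs_le.1 (Real.abs_exp_sub_one_sub_id_le (hx j))).2
        have := (abs_le.1 (Real.abs_exp_sub_one_sub_id_le (x := -x j) (by simpa using hx j))).2
        simp
        nlinarith
      · simp [xi, hk]
    calc _ ≤ ∑ k : Fin m, (2 + (if k = i then 2 * x j ^ 2 else 0)) := Finset.sum_le_sum fun k _ => h2 k
      _ = 2 * m * (x j ^2 / m + 1) := by
        simp [Finset.sum_add_distrib]; field_simp; ring
      _ ≤ _ := by gcongr; exact Real.add_one_le_exp _
  calc _ ≤ ∏ j, ((2 * m) * Real.exp (x j ^ 2 / m)) :=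
        Finset.prod_le_prod (fun j _ => Finset.sum_nonneg fun _ _ => (Real.exp_pos _).le) fun j _ => h1 j
    _ = (2*m)^(Fintype.card J) * Real.exp ((∑ j, x j ^ 2) / m) := by
        rw [Finset.prod_mul_distrib, ← Real.exp_sum, Finset.sum_div]; simp
    _ ≤ _ := by
        have : (∑ j, x j ^ 2) / m ≤ 1 := by rw [div_le_one hm]; exact hs
        have h3 : ((Fintype.card (J → Fin m × Bool) : ℕ) : ℝ) = (2*m)^(Fintype.card J) := by
          simp [mul_comm]
        rw [h3]; gcongr

lemma scalar_upper {J : Type*} [Fintype J] [DecidableEq J] {m : ℕ} (i : Fin m) (Q : ℕ) (hQ : 1 ≤ Q)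
    (a : J → ℝ) (B : ℝ) (hB : 0 ≤ B) (ha : ∀ j, |a j| ≤ B) (hs : ∑ j, a j ^ 2 ≤ m * B ^ 2) :
    ∑ ω : J → Fin m × Bool, |∑ j, xi i (ω j) * a j| ^ Q
      ≤ Fintype.card (J → Fin m × Bool) * ((2 * Real.exp 1 * Q.factorial) * B ^ Q) := by
  rcases hB.eq_or_lt with h0 | hB
  · have : ∀ j, a j = 0 := fun j => abs_nonpos_iff.1 (h0 ▸ ha j)
    simp [this, ← h0, show Q ≠ 0 by omega]
  have key : ∀ s : ℝ, s = 1 ∨ s = -1 → ∑ ω : J → Fin m × Bool, Real.exp (∑ j, xi i (ω j) * (s * (a j / B)))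
      ≤ Fintype.card (J → Fin m × Bool) * Real.exp 1 := by
    intro s hs'
    have hs2 : s ^ 2 = 1 := by rcases hs' with rfl | rfl <;> norm_num
    have hs1 : |s| = 1 := by rcases hs' with rfl | rfl <;> norm_num
    apply expsum_le
    · intro j
      rw [abs_mul, hs1, one_mul, abs_div, abs_of_pos hB, div_le_one hB]; exact ha j
    · simp_rw [mul_pow, hs2, one_mul, div_pow]
      rw [← Finset.sum_div, div_le_iff₀ (by positivity)]; exact hs
  have k1 := key 1 (Or.inl rfl)
  have k2 := key (-1) (Or.inr rfl)
  have h : ∀ ω : J → Fin m × Bool, |∑ j, xi i (ω j) * a j| ^ Q ≤ (Q.factorial * B ^ Q) *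
      (Real.exp (∑ j, xi i (ω j) * (1 * (a j / B))) + Real.exp (∑ j, xi i (ω j) * ((-1) * (a j / B)))) := by
    intro ω
    set S := ∑ j, xi i (ω j) * a j with hS
    have e1 : ∑ j, xi i (ω j) * (1 * (a j / B)) = S / B := by
      rw [hS, Finset.sum_div]; exact Finset.sum_congr rfl fun j _ => by ring
    have e2 : ∑ j, xi i (ω j) * ((-1) * (a j / B)) = -(S / B) := by
      rw [hS, Finset.sum_div, ← Finset.sum_neg_distrib]; exact Finset.sum_congr rfl fun j _ => by ring
    rw [e1, e2]
    have h1 := Real.pow_div_factorial_le_exp (|S / B|) (abs_nonneg _) Q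
    have h2 : Real.exp |S / B| ≤ Real.exp (S/B) + Real.exp (-(S/B)) := by
      rcases abs_cases (S/B) with ⟨h, _⟩ | ⟨h, _⟩ <;> rw [h] <;>
        linarith [Real.exp_pos (S/B), Real.exp_pos (-(S/B))]
    have h3 := h1.trans h2
    rw [div_le_iff₀ (by positivity), abs_div, abs_of_pos hB, div_pow, div_le_iff₀ (by positivity)] at h3
    linarith
  calc _ ≤ ∑ ω : J → Fin m × Bool, _ := Finset.sum_le_sum fun ω _ => h ω
    _ = (Q.factorial * B ^ Q) * (∑ ω : J → Fin m × Bool, Real.exp (∑ j, xi i (ω j) * (1 * (a j / B))) +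
        ∑ ω : J → Fin m × Bool, Real.exp (∑ j, xi i (ω j) * ((-1) * (a j / B)))) := by
        rw [← Finset.mul_sum, Finset.sum_add_distrib]
    _ ≤ (Q.factorial * B ^ Q) * (Fintype.card (J → Fin m × Bool) * Real.exp 1 + Fintype.card (J → Fin m × Bool) * Real.exp 1) := by
        gcongr
    _ = _ := by ring

lemma sum_signs_sq {J : Type*} [Fintype J] [DecidableEq J] (a : J → ℝ) :
    ∑ ε : J → Bool, (∑ j, sg (ε j) * a j) ^ 2 = Fintype.card (J → Bool) * ∑ j, a j ^ 2 := by
  have h : ∀ j k, ∑ ε : J → Bool, sg (ε j) * sg (ε k) = if j = k then (Fintype.card (J → Bool) : ℝ) else 0 := by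
    intro j k
    split_ifs with hjk
    · subst hjk
      have : ∀ ε : J → Bool, sg (ε j) * sg (ε j) = 1 := by
        intro ε; cases ε j <;> simp [sg]
      simp [this]
    · have hinv : Function.Involutive (fun ε : J → Bool => Function.update ε j (!(ε j))) := by
        intro ε; simp
      set P : Equiv.Perm (J → Bool) := hinv.toPerm with hP
      have := Equiv.sum_comp P (fun ε : J → Bool => sg (ε j) * sg (ε k))
      have h2 : ∀ ε : J → Bool, sg ((P ε) j) * sg ((P ε) k) = -(sg (ε j) * sg (ε k)) := by
        intro ε
        simp only [hP, Function.Involutive.coe_toPerm, Function.update_self, Function.update_of_ne (Ne.symm hjk)]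
        cases ε j <;> cases ε k <;> simp [sg]
      simp_rw [h2, Finset.sum_neg_distrib] at this
      linarith
  simp_rw [sq, Finset.sum_mul_sum]
  rw [Finset.sum_comm]
  simp_rw [Finset.sum_comm (s := (Finset.univ : Finset (J → Bool)))]
  have : ∀ j k, ∑ ε : J → Bool, sg (ε j) * a j * (sg (ε k) * a k) = (if j = k then (Fintype.card (J → Bool) : ℝ) else 0) * (a j * a k) := by
    intro j k
    rw [← h, Finset.sum_mul]; exact Finset.sum_congr rfl fun _ _ => by ring
  simp_rw [this]
  simp [Finset.mul_sum]

lemma scalar_lower {J : Type*} [Fintype J] [DecidableEq J] (a : J → ℝ) (r : ℝ) (hr : 2 < r) :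
    (Fintype.card (J → Bool) : ℝ) ^ r⁻¹ * (∑ j, |a j| ^ (2:ℝ)) ^ (2:ℝ)⁻¹ ≤
      (∑ ε : J → Bool, |∑ j, sg (ε j) * a j| ^ r) ^ r⁻¹ := by
  set n : ℝ := ((Fintype.card (J → Bool) : ℕ) : ℝ) with hn
  have hn0 : 0 < n := by rw [hn]; exact_mod_cast Fintype.card_pos
  have h := Real.rpow_arith_mean_le_arith_mean_rpow (Finset.univ : Finset (J → Bool)) (fun _ => n⁻¹)
    (fun ε => (∑ j, sg (ε j) * a j) ^ 2) (fun _ _ => by positivity) (by simp [hn]) (fun _ _ => by positivity)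
    (p := r / 2) (by linarith)
  rw [← Finset.mul_sum, ← Finset.mul_sum, sum_signs_sq, ← hn, inv_mul_cancel_left₀ hn0.ne'] at h
  have e : ∀ ε : J → Bool, ((∑ j, sg (ε j) * a j) ^ 2) ^ (r/2) = |∑ j, sg (ε j) * a j| ^ r := by
    intro ε
    rw [← sq_abs, ← Real.rpow_natCast, ← Real.rpow_mul (abs_nonneg _)]; congr 1; push_cast; ring
  simp_rw [e] at h
  have e2 : ∑ j, |a j| ^ (2:ℝ) = ∑ j, a j ^ 2 := by simp
  rw [e2]
  set A := ∑ j, a j ^ 2 with hA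
  have hA0 : 0 ≤ A := by positivity
  set S := ∑ ε : J → Bool, |∑ j, sg (ε j) * a j| ^ r with hS
  have hr0 : 0 < r := by linarith
  have h' : n * A ^ (r/2) ≤ S := by
    have := mul_le_mul_of_nonneg_left h hn0.le
    rwa [mul_inv_cancel_left₀ hn0.ne'] at this
  calc n ^ r⁻¹ * A ^ (2:ℝ)⁻¹ = (n * A ^ (r/2)) ^ r⁻¹ := by
        rw [Real.mul_rpow hn0.le (by positivity), ← Real.rpow_mul hA0]; congr 2; field_simp
    _ ≤ _ := by gcongr

lemma solid' {α : Type*} [MeasurableSpace α] {μ : Measure α} (Y : QuasiKothe α μ) {f g : α → ℝ}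
    (h : ∀ t, |f t| ≤ |g t|) : Y.N f ≤ Y.N g := Y.solid (Filter.Eventually.of_forall h)

lemma pconvex_fintype {α : Type*} {N : (α → ℝ) → ℝ≥0∞} {p : ℝ} {C : ℝ≥0∞}
    (h : PConvexC N p C) {ι : Type*} [Fintype ι] (f : ι → α → ℝ) :
    N (fun t => (∑ i, |f i t| ^ p) ^ p⁻¹) ≤ C * (∑ i, N (f i) ^ p) ^ p⁻¹ := by
  have e := (Fintype.equivFin ι).symm
  have := h _ (fun i => f (e i))
  have h1 : ∀ t, ∑ i, |f (e i) t| ^ p = ∑ i, |f i t| ^ p := fun t =>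
    Equiv.sum_comp e (fun i => |f i t| ^ p)
  have h2 : ∑ i, N (f (e i)) ^ p = ∑ i, N (f i) ^ p := Equiv.sum_comp e (fun i => N (f i) ^ p)
  simpa only [h1, h2] using this

lemma qconcave_fintype {α : Type*} {N : (α → ℝ) → ℝ≥0∞} {p : ℝ} {C : ℝ≥0∞}
    (h : QConcaveC N p C) {ι : Type*} [Fintype ι] (f : ι → α → ℝ) :
    C * (∑ i, N (f i) ^ p) ^ p⁻¹ ≤ N (fun t => (∑ i, |f i t| ^ p) ^ p⁻¹) := by
  have e := (Fintype.equivFin ι).symm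
  have := h _ (fun i => f (e i))
  have h1 : ∀ t, ∑ i, |f (e i) t| ^ p = ∑ i, |f i t| ^ p := fun t =>
    Equiv.sum_comp e (fun i => |f i t| ^ p)
  have h2 : ∑ i, N (f (e i)) ^ p = ∑ i, N (f i) ^ p := Equiv.sum_comp e (fun i => N (f i) ^ p)
  simpa only [h1, h2] using this

lemma single_le_lp {ι : Type*} [Fintype ι] (a : ι → ℝ) (Q : ℝ) (hQ : 0 < Q) (i : ι) :
    |a i| ≤ (∑ i, |a i| ^ Q) ^ Q⁻¹ := by
  calc |a i| = (|a i| ^ Q) ^ Q⁻¹ := by rw [← Real.rpow_mul (abs_nonneg _), mul_inv_cancel₀ hQ.ne', Real.rpow_one]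
    _ ≤ _ := by
      gcongr
      exact Finset.single_le_sum (f := fun i => |a i| ^ Q) (fun _ _ => by positivity) (Finset.mem_univ i)

lemma conc_mono {α : Type*} [MeasurableSpace α] {μ : Measure α} (Y : QuasiKothe α μ)
    {q Q : ℝ} (hq : 0 < q) (hqQ : q < Q) {c : ℝ≥0∞} (h : QConcaveC Y.N q c) :
    QConcaveC Y.N Q c := by
  intro n f
  have hQ : 0 < Q := hq.trans hqQ
  by_cases htop : ∃ i, Y.N (f i) = ⊤
  · obtain ⟨i, hi⟩ := htop
    have : Y.N (f i) ≤ Y.N (fun t => (∑ i, |f i t| ^ Q) ^ Q⁻¹) :=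
      solid' Y fun t => (single_le_lp (fun i => f i t) Q hQ i).trans (le_abs_self _)
    rw [hi, top_le_iff] at this
    rw [this]; exact le_top
  push Not at htop
  set a : Fin n → ℝ := fun i => (Y.N (f i)).toReal with ha
  have ha0 : ∀ i, 0 ≤ a i := fun i => ENNReal.toReal_nonneg
  have haN : ∀ i, Y.N (f i) = ENNReal.ofReal (a i) := fun i => (ENNReal.ofReal_toReal (htop i)).symm
  set A : ℝ := ∑ i, a i ^ Q with hA
  have hA0 : 0 ≤ A := Finset.sum_nonneg fun i _ => Real.rpow_nonneg (ha0 i) _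
  have hAN : ∑ i, Y.N (f i) ^ Q = ENNReal.ofReal A := by
    rw [hA, ENNReal.ofReal_sum_of_nonneg fun i _ => Real.rpow_nonneg (ha0 i) _]
    exact Finset.sum_congr rfl fun i _ => by rw [haN, ENNReal.ofReal_rpow_of_nonneg (ha0 i) hQ.le]
  rw [hAN]
  rcases hA0.eq_or_lt with h0 | hApos
  · rw [← h0]; simp [hQ]
  set l : Fin n → ℝ := fun i => a i ^ ((Q - q) / q) with hl
  have hl0 : ∀ i, 0 ≤ l i := fun i => Real.rpow_nonneg (ha0 i) _
  have h1 := h n (fun i t => l i * f i t)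
  have e1 : ∀ i, Y.N (fun t => l i * f i t) ^ q = ENNReal.ofReal (a i ^ Q) := by
    intro i
    rw [Y.smul_eq, abs_of_nonneg (hl0 i), haN, ← ENNReal.ofReal_mul (hl0 i),
      ENNReal.ofReal_rpow_of_nonneg (mul_nonneg (hl0 i) (ha0 i)) hq.le,
      Real.mul_rpow (hl0 i) (ha0 i), hl, ← Real.rpow_mul (ha0 i), ← Real.rpow_add_of_nonneg (ha0 i)]
    · congr 2; field_simp; ring
    · rw [div_mul_cancel₀ _ hq.ne']; linarith
    · exact hq.le
  simp_rw [e1] at h1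
  rw [← ENNReal.ofReal_sum_of_nonneg (fun i _ => Real.rpow_nonneg (ha0 i) _), ← hA] at h1
  have h2 : Y.N (fun t => (∑ i, |l i * f i t| ^ q) ^ q⁻¹) ≤
      Y.N (fun t => A ^ (q⁻¹ - Q⁻¹) * (∑ i, |f i t| ^ Q) ^ Q⁻¹) := by
    refine solid' Y fun t => ?_
    rw [abs_of_nonneg (by positivity), abs_of_nonneg (by positivity)]
    have hd : 0 < Q - q := by linarith
    have hconj : (Q/q).HolderConjugate (Q/(Q-q)) := by
      rw [Real.holderConjugate_iff]
      refine ⟨by rw [lt_div_iff₀ hq]; linarith, by field_simp; ring⟩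
    have hh := Real.inner_le_Lp_mul_Lq_of_nonneg Finset.univ hconj (f := fun i => |f i t| ^ q)
      (g := fun i => l i ^ q) (fun i _ => by positivity) (fun i _ => Real.rpow_nonneg (hl0 i) _)
    have e2 : ∀ i, (|f i t| ^ q) ^ (Q/q) = |f i t| ^ Q := fun i => by
      rw [← Real.rpow_mul (abs_nonneg _)]; congr 1; field_simp
    have e3 : ∀ i, (l i ^ q) ^ (Q/(Q-q)) = a i ^ Q := fun i => by
      rw [← Real.rpow_mul (hl0 i), hl, ← Real.rpow_mul (ha0 i)]; congr 1; field_simp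
    simp_rw [e2, e3] at hh
    rw [← hA] at hh
    calc (∑ i, |l i * f i t| ^ q) ^ q⁻¹ = (∑ i, |f i t| ^ q * l i ^ q) ^ q⁻¹ := by
          congr 1; refine Finset.sum_congr rfl fun i _ => ?_
          rw [abs_mul, abs_of_nonneg (hl0 i), Real.mul_rpow (hl0 i) (abs_nonneg _), mul_comm]
      _ ≤ ((∑ i, |f i t| ^ Q) ^ (1 / (Q/q)) * A ^ (1/(Q/(Q-q)))) ^ q⁻¹ := by
          refine Real.rpow_le_rpow (Finset.sum_nonneg fun i _ => mul_nonneg (by positivity) (Real.rpow_nonneg (hl0 i) _)) hh (by positivity)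
      _ = _ := by
          rw [Real.mul_rpow (by positivity) (by positivity), ← Real.rpow_mul (by positivity), ← Real.rpow_mul hA0, mul_comm]
          congr 2 <;> field_simp
  rw [Y.smul_eq, abs_of_nonneg (by positivity)] at h2
  have h3 := h1.trans h2
  rw [ENNReal.ofReal_rpow_of_pos hApos, show q⁻¹ = (q⁻¹ - Q⁻¹) + Q⁻¹ by ring, Real.rpow_add hApos,
    ENNReal.ofReal_mul (by positivity)] at h3
  rw [ENNReal.ofReal_rpow_of_pos hApos]
  have hp : 0 < A ^ (q⁻¹ - Q⁻¹) := by positivity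
  rw [show q⁻¹ - Q⁻¹ + Q⁻¹ - Q⁻¹ = q⁻¹ - Q⁻¹ by ring, mul_left_comm] at h3
  exact (ENNReal.mul_le_mul_iff_right (by simpa using hp) ENNReal.ofReal_ne_top).1 h3

lemma sq_bound {β : Type*} [MeasurableSpace β] {ν : Measure β} (Y : QuasiKothe β ν)
    {r : ℝ} (hr : 2 < r) {C : ℝ≥0∞} (hY : PConvexC Y.N r C) {J : Type*} [Fintype J] [DecidableEq J]
    (a : J → β → ℝ) (V : ℝ≥0∞)
    (hV : ∀ ε : J → Bool, Y.N (fun s => ∑ j, sg (ε j) * a j s) ≤ V) :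
    Y.N (fun s => (∑ j, |a j s| ^ (2:ℝ)) ^ (2:ℝ)⁻¹) ≤ C * V := by
  have hr0 : 0 < r := by linarith
  set n : ℕ := Fintype.card (J → Bool) with hn
  have hn0 : 0 < n := Fintype.card_pos
  have hnr : (0:ℝ) < (n:ℝ) ^ r⁻¹ := by positivity
  have h1 : ENNReal.ofReal ((n:ℝ) ^ r⁻¹) * Y.N (fun s => (∑ j, |a j s| ^ (2:ℝ)) ^ (2:ℝ)⁻¹) ≤
      Y.N (fun s => (∑ ε : J → Bool, |∑ j, sg (ε j) * a j s| ^ r) ^ r⁻¹) := by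
    rw [← abs_of_pos hnr, ← Y.smul_eq]
    refine solid' Y fun s => ?_
    rw [abs_of_nonneg (by positivity), abs_of_nonneg (by positivity)]
    exact scalar_lower (fun j => a j s) r hr
  have h2 := h1.trans (pconvex_fintype hY (fun ε : J → Bool => fun s => ∑ j, sg (ε j) * a j s))
  have h3 : (∑ ε : J → Bool, Y.N (fun s => ∑ j, sg (ε j) * a j s) ^ r) ^ r⁻¹ ≤
      ENNReal.ofReal ((n:ℝ) ^ r⁻¹) * V := by
    calc _ ≤ (∑ ε : J → Bool, V ^ r) ^ r⁻¹ := by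
          gcongr with ε; exact hV ε
      _ = (n * V ^ r) ^ r⁻¹ := by simp [hn]
      _ = _ := by
        rw [ENNReal.mul_rpow_of_nonneg _ _ (by positivity), ← ENNReal.rpow_mul, mul_inv_cancel₀ hr0.ne',
          ENNReal.rpow_one, ← ENNReal.ofReal_rpow_of_pos (by positivity), ENNReal.ofReal_natCast]
  have h4 : ENNReal.ofReal ((n:ℝ) ^ r⁻¹) * Y.N (fun s => (∑ j, |a j s| ^ (2:ℝ)) ^ (2:ℝ)⁻¹) ≤
      ENNReal.ofReal ((n:ℝ) ^ r⁻¹) * (C * V) := by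
    rw [mul_left_comm]
    exact h2.trans (by gcongr)
  exact (ENNReal.mul_le_mul_iff_right (by simpa using hnr) ENNReal.ofReal_ne_top).1 h4

lemma rand_bound {β : Type*} [MeasurableSpace β] {ν : Measure β} (Y : QuasiKothe β ν)
    {Q : ℕ} (hQ : 1 ≤ Q) {c : ℝ≥0∞} (hY : QConcaveC Y.N Q c) {p : ℝ} (hp : 0 < p) (hpQ : p ≤ Q)
    {r : ℝ} (hr : 0 < r) {J : Type*} [Fintype J] [DecidableEq J]
    (a : J → β → ℝ) {m : ℕ} (hm : 1 ≤ m) (V C : ℝ≥0∞)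
    (hV : ∀ ω : J → Fin m × Bool,
      V ≤ C * (∑ i, Y.N (fun s => ∑ j, xi i (ω j) * a j s) ^ p) ^ p⁻¹) :
    c * V ≤ C * (m : ℝ≥0∞) ^ p⁻¹ * ENNReal.ofReal (2 * Real.exp 1 * Q.factorial) ^ (Q:ℝ)⁻¹ *
      Y.N (fun s => (∑ j, |a j s| ^ r) ^ r⁻¹ +
        (Real.sqrt m)⁻¹ * (∑ j, |a j s| ^ (2:ℝ)) ^ (2:ℝ)⁻¹) := by
  have hQ0 : (0:ℝ) < Q := by exact_mod_cast hQ
  have hm0 : (0:ℝ) < m := by exact_mod_cast hm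
  set K : ℝ := 2 * Real.exp 1 * Q.factorial with hK
  have hK0 : 0 < K := by positivity
  set G : β → ℝ := fun s => (∑ j, |a j s| ^ r) ^ r⁻¹ +
        (Real.sqrt m)⁻¹ * (∑ j, |a j s| ^ (2:ℝ)) ^ (2:ℝ)⁻¹ with hG
  have hG0 : ∀ s, 0 ≤ G s := fun s => by rw [hG]; positivity
  set n : ℕ := Fintype.card (J → Fin m × Bool) with hn
  have : Nonempty (Fin m) := ⟨⟨0, hm⟩⟩
  have hn0 : 0 < n := Fintype.card_pos
  set F : Fin m → (J → Fin m × Bool) → ℝ≥0∞ :=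
    fun i ω => Y.N (fun s => ∑ j, xi i (ω j) * a j s) with hF
  have h1 : ∀ i, c ^ (Q:ℝ) * ∑ ω, F i ω ^ (Q:ℝ) ≤ n * ENNReal.ofReal K * Y.N G ^ (Q:ℝ) := by
    intro i
    have hc := qconcave_fintype hY (fun ω : J → Fin m × Bool => fun s => ∑ j, xi i (ω j) * a j s)
    have h2 : Y.N (fun s => (∑ ω : J → Fin m × Bool, |∑ j, xi i (ω j) * a j s| ^ (Q:ℝ)) ^ (Q:ℝ)⁻¹) ≤
        Y.N (fun s => ((n * K) ^ (Q:ℝ)⁻¹) * G s) := by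
      refine solid' Y fun s => ?_
      have := hG0 s
      rw [abs_of_nonneg (by positivity), abs_of_nonneg (by positivity)]
      have hA0 : 0 ≤ ∑ j, a j s ^ 2 := by positivity
      have e2 : (∑ j, |a j s| ^ (2:ℝ)) ^ (2:ℝ)⁻¹ = Real.sqrt (∑ j, a j s ^ 2) := by
        rw [Real.sqrt_eq_rpow]; simp
      have hsc := scalar_upper i Q hQ (fun j => a j s) (G s) (hG0 s)
        (fun j => (single_le_lp (fun j => a j s) r hr j).trans (by
          rw [hG]; simp only [le_add_iff_nonneg_right]; positivity))
        (by
          have h5 : (Real.sqrt m)⁻¹ * Real.sqrt (∑ j, a j s ^ 2) ≤ G s := by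
            rw [hG]; simp only [e2, le_add_iff_nonneg_left]; positivity
          have h6 := pow_le_pow_left₀ (by positivity) h5 2
          rw [mul_pow, inv_pow, Real.sq_sqrt hm0.le, Real.sq_sqrt hA0, inv_mul_le_iff₀ hm0] at h6
          exact h6)
      simp only [Real.rpow_natCast]
      calc _ ≤ (n * (K * G s ^ Q)) ^ (Q:ℝ)⁻¹ := by gcongr
        _ = _ := by
          rw [← mul_assoc, Real.mul_rpow (by positivity) (by positivity), ← Real.rpow_natCast (G s),
            ← Real.rpow_mul (hG0 s), mul_inv_cancel₀ hQ0.ne', Real.rpow_one]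
    have h3 := hc.trans h2
    rw [Y.smul_eq, abs_of_nonneg (by positivity)] at h3
    have h4 := ENNReal.rpow_le_rpow h3 hQ0.le
    rw [ENNReal.mul_rpow_of_nonneg _ _ hQ0.le, ENNReal.mul_rpow_of_nonneg _ _ hQ0.le,
      ← ENNReal.rpow_mul, inv_mul_cancel₀ hQ0.ne', ENNReal.rpow_one,
      ENNReal.ofReal_rpow_of_nonneg (by positivity) hQ0.le, ← Real.rpow_mul (by positivity),
      inv_mul_cancel₀ hQ0.ne', Real.rpow_one, ENNReal.ofReal_mul (by positivity), ENNReal.ofReal_natCast] at h4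
    exact h4
  have h2 : ∀ ω, V ^ (Q:ℝ) ≤ C ^ (Q:ℝ) * ((m : ℝ≥0∞) ^ (Q / p - 1) * ∑ i, F i ω ^ (Q:ℝ)) := by
    intro ω
    have h3 := ENNReal.rpow_le_rpow (hV ω) hQ0.le
    rw [ENNReal.mul_rpow_of_nonneg _ _ hQ0.le, ← ENNReal.rpow_mul] at h3
    refine h3.trans ?_
    gcongr
    have h4 := ENNReal.rpow_sum_le_const_mul_sum_rpow Finset.univ (fun i => F i ω ^ p) (p := Q / p)
      (by rw [le_div_iff₀ hp]; linarith)
    simp_rw [← ENNReal.rpow_mul] at h4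
    rw [mul_div_cancel₀ _ hp.ne'] at h4
    simpa [div_eq_inv_mul] using h4
  have h3 : (n : ℝ≥0∞) * (c * V) ^ (Q:ℝ) ≤ n * (C * (m : ℝ≥0∞) ^ p⁻¹ * ENNReal.ofReal K ^ (Q:ℝ)⁻¹ * Y.N G) ^ (Q:ℝ) := by
    calc (n : ℝ≥0∞) * (c * V) ^ (Q:ℝ) = c ^ (Q:ℝ) * ∑ ω : J → Fin m × Bool, V ^ (Q:ℝ) := by
          rw [ENNReal.mul_rpow_of_nonneg _ _ hQ0.le]; simp only [Finset.sum_const, Finset.card_univ, nsmul_eq_mul, ← hn]; ring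
      _ ≤ c ^ (Q:ℝ) * ∑ ω : J → Fin m × Bool, C ^ (Q:ℝ) * ((m : ℝ≥0∞) ^ (Q / p - 1) * ∑ i, F i ω ^ (Q:ℝ)) := by
          gcongr with ω; exact h2 ω
      _ = C ^ (Q:ℝ) * (m : ℝ≥0∞) ^ (Q / p - 1) * ∑ i, (c ^ (Q:ℝ) * ∑ ω, F i ω ^ (Q:ℝ)) := by
          rw [← Finset.mul_sum, ← Finset.mul_sum, ← Finset.mul_sum, Finset.sum_comm]; ring
      _ ≤ C ^ (Q:ℝ) * (m : ℝ≥0∞) ^ (Q / p - 1) * ∑ i : Fin m, (n * ENNReal.ofReal K * Y.N G ^ (Q:ℝ)) := by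
          exact mul_le_mul' le_rfl (Finset.sum_le_sum fun i _ => h1 i)
      _ = n * (C ^ (Q:ℝ) * ((m : ℝ≥0∞) ^ (Q / p - 1) * (m : ℝ≥0∞) ^ (1:ℝ)) * ENNReal.ofReal K * Y.N G ^ (Q:ℝ)) := by
          simp only [Finset.sum_const, Finset.card_univ, nsmul_eq_mul, Fintype.card_fin, ENNReal.rpow_one]; ring
      _ = _ := by
          rw [← ENNReal.rpow_add _ _ (by exact_mod_cast hm0.ne') (by simp)]
          simp only [ENNReal.mul_rpow_of_nonneg _ _ hQ0.le, ← ENNReal.rpow_mul]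
          rw [inv_mul_cancel₀ hQ0.ne', ENNReal.rpow_one, sub_add_cancel, div_eq_inv_mul]
  have h4 := (ENNReal.mul_le_mul_iff_right (by exact_mod_cast hn0.ne') (by simp)).1 h3
  exact (ENNReal.rpow_le_rpow_iff hQ0).1 h4

def Phi {α J : Type*} (code : α → J) (u : α → ℝ) : (J → ℝ) →ₗ[ℝ] (α → ℝ) where
  toFun b := fun t => b (code t) * u t
  map_add' a b := by ext t; simp [add_mul]
  map_smul' c b := by ext t; simp [mul_assoc]

lemma exists_m (E : ℝ≥0∞) (hE : E ≠ ⊤) {p : ℝ} (hp : 2 < p) : ∃ m : ℕ, 1 ≤ m ∧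
    E * ((m : ℝ≥0∞) ^ p⁻¹ * ENNReal.ofReal (Real.sqrt m)⁻¹) ≤ 2⁻¹ := by
  have hlt : 0 < 2⁻¹ - p⁻¹ := by
    rw [sub_pos]; exact inv_strictAnti₀ (by norm_num) hp
  have ht := ((tendsto_rpow_neg_atTop hlt).comp tendsto_natCast_atTop_atTop).const_mul E.toReal
  rw [mul_zero] at ht
  have hev := (ht.eventually (eventually_le_nhds (b := (2⁻¹:ℝ)) (by norm_num))).and (eventually_ge_atTop 1)
  obtain ⟨m, h1, hm⟩ := hev.exists
  refine ⟨m, hm, ?_⟩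
  have hm0 : (0:ℝ) < m := by exact_mod_cast hm
  rw [← ENNReal.ofReal_toReal hE, ← ENNReal.ofReal_natCast, ENNReal.ofReal_rpow_of_pos hm0,
    ← ENNReal.ofReal_mul (by positivity), ← ENNReal.ofReal_mul (by positivity)]
  have e : (m:ℝ) ^ p⁻¹ * (Real.sqrt m)⁻¹ = (m:ℝ) ^ (-(2⁻¹ - p⁻¹)) := by
    rw [Real.sqrt_eq_rpow, ← Real.rpow_neg hm0.le, ← Real.rpow_add hm0]; congr 1; ring
  rw [e, show (2⁻¹ : ℝ≥0∞) = ENNReal.ofReal 2⁻¹ by rw [ENNReal.ofReal_inv_of_pos (by norm_num)]; simp]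
  exact ENNReal.ofReal_le_ofReal h1

lemma key {α β : Type*} [MeasurableSpace α] [MeasurableSpace β]
    (μ : MeasureTheory.Measure α) (ν : MeasureTheory.Measure β)
    (Y : QuasiKothe β ν) (hYB : Banach Y)
    (r : ℝ) (hr : 2 < r) (hYr : PConvex Y.N r)
    (q : ℝ) (hq : 0 < q) (hYq : QConcave Y.N q)
    (X : QuasiKothe α μ)
    (p : ℝ) (hp : 2 < p) (hXp : PConvex X.N p)
    (hemb : Embeds X.N Y.N) :
    ∃ D : ℝ≥0∞, D ≠ ⊤ ∧ ∀ (J : Type) [Fintype J] [DecidableEq J] (code : α → J) (u : α → ℝ),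
      X.N u ≠ ⊤ → ∃ y : J → β → ℝ, ∀ b : J → ℝ,
        Y.N (fun s => (∑ j, |b j * y j s| ^ (2:ℝ)) ^ (2:ℝ)⁻¹) ≤ D * X.N (Phi code u b) ∧
        X.N (Phi code u b) ≤ D * Y.N (fun s => (∑ j, |b j * y j s| ^ r) ^ r⁻¹) := by
  obtain ⟨CY, hCY, hYr⟩ := hYr
  obtain ⟨CX, hCX, hXp⟩ := hXp
  obtain ⟨cY', hcY', hYq'⟩ := hYq
  obtain ⟨T, c', C, hc', hC, hT'⟩ := hemb
  obtain ⟨cY, hcY0, hcYt, hYq⟩ : ∃ cY : ℝ≥0∞, cY ≠ 0 ∧ cY ≠ ⊤ ∧ QConcaveC Y.N q cY :=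
    ⟨min cY' 1, by simpa using hcY'.ne', by simp, fun n f => le_trans (by gcongr; exact min_le_left _ _) (hYq' n f)⟩
  obtain ⟨c, hc0, hct, hT⟩ : ∃ c : ℝ≥0∞, c ≠ 0 ∧ c ≠ ⊤ ∧
      ∀ f : α → ℝ, X.N f ≠ ⊤ → c * X.N f ≤ Y.N (T f) ∧ Y.N (T f) ≤ C * X.N f :=
    ⟨min c' 1, by simpa using hc'.ne', by simp, fun f hf => ⟨le_trans (by gcongr; exact min_le_left _ _) (hT' f hf).1, (hT' f hf).2⟩⟩
  have hp0 : 0 < p := by linarith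
  have hr0 : 0 < r := by linarith
  set Q : ℕ := ⌈q⌉₊ + ⌈p⌉₊ + 1 with hQ
  have hqQ : q < Q := by
    rw [hQ]; push_cast; linarith [Nat.le_ceil q, Nat.cast_nonneg (α := ℝ) ⌈p⌉₊]
  have hpQ : p ≤ Q := by
    rw [hQ]; push_cast; linarith [Nat.le_ceil p, Nat.cast_nonneg (α := ℝ) ⌈q⌉₊]
  have hYQ := conc_mono Y hq hqQ hYq
  set A : ℝ≥0∞ := cY⁻¹ * (CX * c⁻¹ * ENNReal.ofReal (2 * Real.exp 1 * Q.factorial) ^ (Q:ℝ)⁻¹) with hA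
  have hAt : A ≠ ⊤ := by
    have : ENNReal.ofReal (2 * Real.exp 1 * Q.factorial) ^ (Q:ℝ)⁻¹ ≠ ⊤ :=
      ENNReal.rpow_ne_top_of_nonneg (by positivity) ENNReal.ofReal_ne_top
    exact ENNReal.mul_ne_top (by simpa using hcY0) (ENNReal.mul_ne_top (ENNReal.mul_ne_top hCX (by simpa using hc0)) this)
  obtain ⟨m, hm, hmE⟩ := exists_m (A * (CY * C)) (ENNReal.mul_ne_top hAt (ENNReal.mul_ne_top hCY hC)) hp
  have hmt : (m : ℝ≥0∞) ^ p⁻¹ ≠ ⊤ := ENNReal.rpow_ne_top_of_nonneg (by positivity) (by simp)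
  refine ⟨max (CY * C) (2 * (A * (m : ℝ≥0∞) ^ p⁻¹)), ?_, ?_⟩
  · exact max_ne_top (ENNReal.mul_ne_top hCY hC)
      (ENNReal.mul_ne_top (by simp) (ENNReal.mul_ne_top hAt hmt))
  intro J _ _ code u hu
  set S : (J → ℝ) →ₗ[ℝ] (β → ℝ) := T.comp (Phi code u) with hS
  have hSb : ∀ b : J → ℝ, S b = fun s => ∑ j, b j * S (Pi.single j 1) s := by
    intro b
    conv_lhs => rw [LinearMap.pi_apply_eq_sum_univ S b]
    ext s; simp only [Finset.sum_apply, Pi.smul_apply, smul_eq_mul]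
    refine Finset.sum_congr rfl fun j _ => ?_
    have e : (fun i : J => if j = i then (1:ℝ) else 0) = Pi.single j 1 := by
      ext i; simp [Pi.single_apply, eq_comm]
    rw [e]
  have hfin : ∀ b, X.N (Phi code u b) ≠ ⊤ := by
    intro b
    refine ne_top_of_le_ne_top (b := X.N (fun t => (∑ j, |b j|) * u t)) ?_ (solid' X fun t => ?_)
    · rw [X.smul_eq]; exact ENNReal.mul_ne_top ENNReal.ofReal_ne_top hu
    · simp only [Phi, LinearMap.coe_mk, AddHom.coe_mk, abs_mul]
      refine mul_le_mul_of_nonneg_right ?_ (abs_nonneg _)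
      exact (Finset.single_le_sum (f := fun j => |b j|) (fun _ _ => abs_nonneg _) (Finset.mem_univ (code t))).trans (le_abs_self _)
  have hmono : ∀ b b' : J → ℝ, (∀ j, |b j| ≤ |b' j|) → X.N (Phi code u b) ≤ X.N (Phi code u b') := by
    intro b b' h
    refine solid' X fun t => ?_
    simp only [Phi, LinearMap.coe_mk, AddHom.coe_mk, abs_mul]
    exact mul_le_mul_of_nonneg_right (h _) (abs_nonneg _)
  have hsg : ∀ z, |sg z| = 1 := by intro z; cases z <;> simp [sg]
  refine ⟨fun j => S (Pi.single j 1), fun b => ?_⟩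
  set y := fun j => S (Pi.single j 1) with hy
  set n := X.N (Phi code u b) with hn
  have hsq : Y.N (fun s => (∑ j, |b j * y j s| ^ (2:ℝ)) ^ (2:ℝ)⁻¹) ≤ CY * (C * n) := by
    refine sq_bound Y hr hYr (fun j s => b j * y j s) _ fun ε => ?_
    have e : (fun s => ∑ j, sg (ε j) * (b j * y j s)) = S (fun j => sg (ε j) * b j) := by
      rw [hSb]; ext s; exact Finset.sum_congr rfl fun j _ => by rw [hy]; ring
    rw [e]
    refine ((hT _ (hfin _)).2).trans ?_
    gcongr
    exact hmono _ _ fun j => by rw [abs_mul, hsg, one_mul]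
  refine ⟨?_, ?_⟩
  · refine hsq.trans ?_
    rw [← mul_assoc]; gcongr; exact le_max_left _ _
  have hrand := rand_bound Y (by omega) hYQ hp0 hpQ hr0 (fun j s => b j * y j s) hm n (CX * c⁻¹) (by
    intro ω
    have e : ∀ i, (fun s => ∑ j, xi i (ω j) * (b j * y j s)) = S (fun j => xi i (ω j) * b j) := by
      intro i
      rw [hSb]; ext s; exact Finset.sum_congr rfl fun j _ => by rw [hy]; ring
    simp_rw [e]
    have h1 := pconvex_fintype hXp (fun i : Fin m => Phi code u (fun j => xi i (ω j) * b j))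
    have h2 : n ≤ X.N (fun t => (∑ i : Fin m, |Phi code u (fun j => xi i (ω j) * b j) t| ^ p) ^ p⁻¹) := by
      refine solid' X fun t => ?_
      refine le_trans ?_ (le_abs_self _)
      refine le_trans ?_ (single_le_lp (fun i : Fin m => Phi code u (fun j => xi i (ω j) * b j) t) p hp0 (ω (code t)).1)
      simp [Phi, xi, abs_mul, hsg]
    refine (h2.trans h1).trans ?_
    rw [mul_assoc]
    gcongr
    have h3 : ∀ i : Fin m, X.N (Phi code u (fun j => xi i (ω j) * b j)) ≤
        c⁻¹ * Y.N (S (fun j => xi i (ω j) * b j)) := by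
      intro i
      have := (hT _ (hfin (fun j => xi i (ω j) * b j))).1
      calc _ = c⁻¹ * (c * X.N (Phi code u (fun j => xi i (ω j) * b j))) := by
            rw [← mul_assoc, ENNReal.inv_mul_cancel hc0 hct, one_mul]
        _ ≤ _ := by gcongr; exact this
    calc _ ≤ (∑ i : Fin m, (c⁻¹ * Y.N (S (fun j => xi i (ω j) * b j))) ^ p) ^ p⁻¹ := by
          gcongr with i; exact h3 i
      _ = _ := by
          simp_rw [ENNReal.mul_rpow_of_nonneg _ _ hp0.le]
          rw [← Finset.mul_sum, ENNReal.mul_rpow_of_nonneg _ _ (by positivity), ← ENNReal.rpow_mul,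
            mul_inv_cancel₀ hp0.ne', ENNReal.rpow_one])
  set M := Y.N (fun s => (∑ j, |b j * y j s| ^ r) ^ r⁻¹) with hM
  have hG : Y.N (fun s => (∑ j, |b j * y j s| ^ r) ^ r⁻¹ +
        (Real.sqrt m)⁻¹ * (∑ j, |b j * y j s| ^ (2:ℝ)) ^ (2:ℝ)⁻¹) ≤
        M + ENNReal.ofReal (Real.sqrt m)⁻¹ * (CY * (C * n)) := by
    refine (hYB _ _).trans ?_
    rw [Y.smul_eq, abs_of_nonneg (by positivity)]
    gcongr
  have h5 : n ≤ A * (m : ℝ≥0∞) ^ p⁻¹ * M + 2⁻¹ * n := by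
    calc n = cY⁻¹ * (cY * n) := by rw [← mul_assoc, ENNReal.inv_mul_cancel hcY0 hcYt, one_mul]
      _ ≤ cY⁻¹ * (CX * c⁻¹ * (m : ℝ≥0∞) ^ p⁻¹ * ENNReal.ofReal (2 * Real.exp 1 * Q.factorial) ^ (Q:ℝ)⁻¹ *
          (M + ENNReal.ofReal (Real.sqrt m)⁻¹ * (CY * (C * n)))) := by
          exact mul_le_mul' le_rfl (hrand.trans (mul_le_mul' le_rfl hG))
      _ = A * (m : ℝ≥0∞) ^ p⁻¹ * M + (A * (CY * C) * ((m : ℝ≥0∞) ^ p⁻¹ * ENNReal.ofReal (Real.sqrt m)⁻¹)) * n := by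
          rw [hA]; ring
      _ ≤ _ := by gcongr
  have h6 : 2⁻¹ * n ≤ A * (m : ℝ≥0∞) ^ p⁻¹ * M := by
    have h7 : 2⁻¹ * n + 2⁻¹ * n ≤ A * (m : ℝ≥0∞) ^ p⁻¹ * M + 2⁻¹ * n := by
      rwa [← add_mul, ENNReal.inv_two_add_inv_two, one_mul]
    exact (ENNReal.add_le_add_iff_right (ENNReal.mul_ne_top (by simp) (hfin b))).1 h7
  calc n = 2 * (2⁻¹ * n) := by rw [← mul_assoc, ENNReal.mul_inv_cancel (by simp) (by simp), one_mul]
    _ ≤ 2 * (A * (m : ℝ≥0∞) ^ p⁻¹ * M) := by gcongr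
    _ = 2 * (A * (m : ℝ≥0∞) ^ p⁻¹) * M := by ring
    _ ≤ _ := by gcongr; exact le_max_right _ _

lemma N_zero {α : Type*} [MeasurableSpace α] {μ : Measure α} (X : QuasiKothe α μ) :
    X.N (fun _ => 0) = 0 := by
  have := X.smul_eq 0 (fun _ => 0)
  simpa using this

lemma N_sum_abs {α : Type*} [MeasurableSpace α] {μ : Measure α} (X : QuasiKothe α μ) (hX : Banach X)
    {ι : Type*} (s : Finset ι) (f : ι → α → ℝ) :
    X.N (fun t => ∑ k ∈ s, |f k t|) ≤ ∑ k ∈ s, X.N (f k) := by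
  classical
  induction s using Finset.induction_on with
  | empty => simp [N_zero]
  | insert a s ha ih =>
    simp only [Finset.sum_insert ha]
    refine (hX (fun t => |f a t|) (fun t => ∑ k ∈ s, |f k t|)).trans ?_
    gcongr
    exact solid' X fun t => by simp

lemma lr_le_l2 {ι : Type*} [Fintype ι] (a : ι → ℝ) {r : ℝ} (hr : 2 < r) :
    (∑ i, |a i| ^ r) ^ r⁻¹ ≤ (∑ i, |a i| ^ (2:ℝ)) ^ (2:ℝ)⁻¹ := by
  have hr0 : 0 < r := by linarith
  set A := ∑ i, |a i| ^ (2:ℝ) with hA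
  have hA0 : 0 ≤ A := by positivity
  set s := A ^ (2:ℝ)⁻¹ with hs
  have hs0 : 0 ≤ s := by positivity
  have hsA : A = s ^ (2:ℝ) := by rw [hs, ← Real.rpow_mul hA0]; norm_num
  have h1 : ∑ i, |a i| ^ r ≤ s ^ r := by
    calc ∑ i, |a i| ^ r ≤ ∑ i, s ^ (r - 2) * |a i| ^ (2:ℝ) := by
          refine Finset.sum_le_sum fun i _ => ?_
          have h2 : |a i| ≤ s := single_le_lp a 2 (by norm_num) i
          calc |a i| ^ r = |a i| ^ (r - 2) * |a i| ^ (2:ℝ) := by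
                rw [← Real.rpow_add_of_nonneg (abs_nonneg _) (by linarith) (by norm_num)]; congr 1; ring
            _ ≤ _ := by
                gcongr
      _ = s ^ r := by
          rw [← Finset.mul_sum, ← hA, hsA, ← Real.rpow_add_of_nonneg hs0 (by linarith) (by norm_num)]; congr 1; ring
  calc _ ≤ (s ^ r) ^ r⁻¹ := by gcongr
    _ = s := by rw [← Real.rpow_mul hs0, mul_inv_cancel₀ hr0.ne', Real.rpow_one]

lemma final_bound {α β : Type*} [MeasurableSpace α] [MeasurableSpace β]
    {μ : MeasureTheory.Measure α} {ν : MeasureTheory.Measure β}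
    (Y : QuasiKothe β ν) (r : ℝ) (hr : 2 < r) {CY : ℝ≥0∞} (hYr : PConvexC Y.N r CY)
    (X : QuasiKothe α μ) (hXB : Banach X) (D : ℝ≥0∞)
    (hD : ∀ (J : Type) [Fintype J] [DecidableEq J] (code : α → J) (u : α → ℝ),
      X.N u ≠ ⊤ → ∃ y : J → β → ℝ, ∀ b : J → ℝ,
        Y.N (fun s => (∑ j, |b j * y j s| ^ (2:ℝ)) ^ (2:ℝ)⁻¹) ≤ D * X.N (Phi code u b) ∧
        X.N (Phi code u b) ≤ D * Y.N (fun s => (∑ j, |b j * y j s| ^ r) ^ r⁻¹)) :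
    PConvexC X.N r (D * (CY * D) + 1) := by
  intro n f
  have hr0 : 0 < r := by linarith
  set R : ℝ≥0∞ := (∑ i, X.N (f i) ^ r) ^ r⁻¹ with hR
  have hfR : ∀ i, X.N (f i) ≤ R := by
    intro i
    calc X.N (f i) = (X.N (f i) ^ r) ^ r⁻¹ := by
          rw [← ENNReal.rpow_mul, mul_inv_cancel₀ hr0.ne', ENNReal.rpow_one]
      _ ≤ R := by
          rw [hR]; gcongr
          exact Finset.single_le_sum (f := fun i => X.N (f i) ^ r) (fun _ _ => zero_le) (Finset.mem_univ i)
  by_cases hRt : R = ⊤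
  · rw [hRt, ENNReal.mul_top (by simp)]; exact le_top
  set u : α → ℝ := fun t => ∑ k, |f k t| with hu
  have hu0 : ∀ t, 0 ≤ u t := fun t => Finset.sum_nonneg fun _ _ => abs_nonneg _
  have hfu : ∀ k t, |f k t| ≤ u t := fun k t =>
    Finset.single_le_sum (f := fun k => |f k t|) (fun _ _ => abs_nonneg _) (Finset.mem_univ k)
  have huR : X.N u ≤ n * R := by
    refine (N_sum_abs X hXB Finset.univ f).trans ?_
    refine (Finset.sum_le_sum fun k _ => hfR k).trans ?_
    simp
  have hut : X.N u ≠ ⊤ := ne_top_of_le_ne_top (ENNReal.mul_ne_top (by simp) hRt) huR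
  set L : ℕ := n * n + 1 with hL
  have hL0 : (0:ℝ) < L := by rw [hL]; positivity
  have hcode : ∀ t k, ⌊|f k t| * L / u t⌋₊ < L + 1 := by
    intro t k
    refine Nat.lt_succ_of_le (Nat.floor_le_of_le ?_)
    refine div_le_of_le_mul₀ (hu0 t) hL0.le ?_
    nlinarith [hfu k t]
  set code : α → (Fin n → Fin (L + 1)) := fun t k => ⟨⌊|f k t| * L / u t⌋₊, hcode t k⟩ with hcd
  obtain ⟨y, hy⟩ := hD _ code u hut
  set bb : Fin n → (Fin n → Fin (L+1)) → ℝ := fun k j => (j k : ℕ) / L with hbb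
  have hbb0 : ∀ k j, 0 ≤ bb k j := fun k j => by rw [hbb]; positivity
  have hlow : ∀ k t, bb k (code t) * u t ≤ |f k t| := by
    intro k t
    have h1 : ((code t k : ℕ) : ℝ) ≤ |f k t| * L / u t := Nat.floor_le (by have := hu0 t; positivity)
    rcases (hu0 t).eq_or_lt with h0 | h0
    · rw [← h0]; simp
    · rw [le_div_iff₀ h0] at h1
      simp only [hbb]
      rw [div_mul_eq_mul_div, div_le_iff₀ hL0]; exact h1
  have hupp : ∀ k t, |f k t| ≤ bb k (code t) * u t + u t / L := by
    intro k t
    have h1 : |f k t| * L / u t < (code t k : ℕ) + 1 := Nat.lt_floor_add_one _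
    rcases (hu0 t).eq_or_lt with h0 | h0
    · have := hfu k t; rw [← h0] at this ⊢; simpa using this
    · rw [div_lt_iff₀ h0] at h1
      simp only [hbb]
      rw [div_mul_eq_mul_div, ← add_div, le_div_iff₀ hL0]; linarith
  set b : (Fin n → Fin (L+1)) → ℝ := fun j => (∑ k, |bb k j| ^ r) ^ r⁻¹ with hb
  have hb0 : ∀ j, 0 ≤ b j := fun j => by rw [hb]; positivity
  -- comparison of the r-sum with the discretized one
  have hpt : ∀ t, (∑ k, |f k t| ^ r) ^ r⁻¹ ≤ Phi code u b t + (n / L : ℝ) * u t := by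
    intro t
    have h1 : (∑ k, |f k t| ^ r) ^ r⁻¹ ≤ (∑ k, (bb k (code t) * u t + u t / L) ^ r) ^ r⁻¹ := by
      gcongr with k; exact hupp k t
    have h2 := Real.Lp_add_le_of_nonneg Finset.univ (f := fun k => bb k (code t) * u t) (g := fun _ : Fin n => u t / L)
      (p := r) (by linarith) (fun k _ => mul_nonneg (hbb0 _ _) (hu0 t)) (fun _ _ => div_nonneg (hu0 t) hL0.le)
    simp only [one_div] at h2
    have h3 : (∑ k, (bb k (code t) * u t) ^ r) ^ r⁻¹ = Phi code u b t := by
      simp only [Phi, LinearMap.coe_mk, AddHom.coe_mk, hb]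
      simp_rw [Real.mul_rpow (hbb0 _ _) (hu0 t), abs_of_nonneg (hbb0 _ _)]
      rw [← Finset.sum_mul, Real.mul_rpow (Finset.sum_nonneg fun _ _ => Real.rpow_nonneg (hbb0 _ _) _)
        (Real.rpow_nonneg (hu0 t) _), ← Real.rpow_mul (hu0 t), mul_inv_cancel₀ hr0.ne', Real.rpow_one]
    have h4 : (∑ _k : Fin n, (u t / L) ^ r) ^ r⁻¹ ≤ (n / L : ℝ) * u t := by
      have h0 : 0 ≤ u t / L := div_nonneg (hu0 t) hL0.le
      simp only [Finset.sum_const, Finset.card_univ, Fintype.card_fin, nsmul_eq_mul]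
      rw [Real.mul_rpow (by positivity) (by positivity), ← Real.rpow_mul h0, mul_inv_cancel₀ hr0.ne', Real.rpow_one]
      have h5 : (n:ℝ) ^ r⁻¹ ≤ n := by
        rcases Nat.eq_zero_or_pos n with h | h
        · rw [h, Nat.cast_zero, Real.zero_rpow (by positivity)]
        · calc (n:ℝ) ^ r⁻¹ ≤ (n:ℝ) ^ (1:ℝ) :=
              Real.rpow_le_rpow_of_exponent_le (by exact_mod_cast h) (inv_le_one_of_one_le₀ (by linarith))
            _ = n := Real.rpow_one _
      calc _ ≤ n * (u t / L) := by gcongr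
        _ = _ := by ring
    linarith
  have hN1 : X.N (fun t => (∑ k, |f k t| ^ r) ^ r⁻¹) ≤
      X.N (Phi code u b) + X.N (fun t => (n / L : ℝ) * u t) := by
    refine le_trans (solid' X fun t => ?_) (hXB _ _)
    rw [abs_of_nonneg (by positivity)]
    exact (hpt t).trans (le_abs_self _)
  have hN2 : X.N (fun t => (n / L : ℝ) * u t) ≤ R := by
    rw [X.smul_eq, abs_of_nonneg (by positivity)]
    calc _ ≤ ENNReal.ofReal (n / L : ℝ) * (n * R) := by gcongr
      _ = ENNReal.ofReal (n / L * n) * R := by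
          rw [← mul_assoc, ENNReal.ofReal_mul (by positivity), ENNReal.ofReal_natCast]
      _ ≤ 1 * R := by
          gcongr
          rw [ENNReal.ofReal_le_one, div_mul_eq_mul_div, div_le_one hL0, hL]
          push_cast; linarith
      _ = R := one_mul _
  have hN3 : X.N (Phi code u b) ≤ D * (CY * D) * R := by
    have h1 := (hy b).2
    set g : Fin n → β → ℝ := fun k s => (∑ j, |bb k j * y j s| ^ r) ^ r⁻¹ with hg
    have h2 : ∀ s, ∑ j, |b j * y j s| ^ r = ∑ k, |g k s| ^ r := by
      intro s
      have e1 : ∀ k, |g k s| ^ r = ∑ j, |bb k j * y j s| ^ r := by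
        intro k
        rw [hg, abs_of_nonneg (by positivity), ← Real.rpow_mul (by positivity), inv_mul_cancel₀ hr0.ne', Real.rpow_one]
      simp_rw [e1]
      rw [Finset.sum_comm]
      refine Finset.sum_congr rfl fun j _ => ?_
      simp_rw [abs_mul, Real.mul_rpow (abs_nonneg _) (abs_nonneg _)]
      rw [← Finset.sum_mul, abs_of_nonneg (hb0 j), hb, ← Real.rpow_mul (by positivity), inv_mul_cancel₀ hr0.ne', Real.rpow_one]
    simp_rw [h2] at h1
    have h3 : ∀ k, Y.N (g k) ≤ D * X.N (f k) := by
      intro k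
      calc Y.N (g k) ≤ Y.N (fun s => (∑ j, |bb k j * y j s| ^ (2:ℝ)) ^ (2:ℝ)⁻¹) := by
            refine solid' Y fun s => ?_
            rw [hg, abs_of_nonneg (by positivity), abs_of_nonneg (by positivity)]
            exact lr_le_l2 _ hr
        _ ≤ D * X.N (Phi code u (bb k)) := (hy (bb k)).1
        _ ≤ _ := by
            gcongr
            refine solid' X fun t => ?_
            simp only [Phi, LinearMap.coe_mk, AddHom.coe_mk]
            rw [abs_of_nonneg (mul_nonneg (hbb0 _ _) (hu0 t))]
            exact hlow k t
    calc _ ≤ D * (CY * (∑ k, Y.N (g k) ^ r) ^ r⁻¹) := h1.trans (mul_le_mul' le_rfl (hYr n g))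
      _ ≤ D * (CY * (∑ k, (D * X.N (f k)) ^ r) ^ r⁻¹) := by
          gcongr with k; exact h3 k
      _ = _ := by
          simp_rw [ENNReal.mul_rpow_of_nonneg _ _ hr0.le]
          rw [← Finset.mul_sum, ENNReal.mul_rpow_of_nonneg _ _ (by positivity), ← ENNReal.rpow_mul,
            mul_inv_cancel₀ hr0.ne', ENNReal.rpow_one]; ring
  calc _ ≤ _ := hN1
    _ ≤ D * (CY * D) * R + R := add_le_add hN3 hN2
    _ = _ := by ring

/-- **Theorem 4.2.** Suppose `Y` is a Banach lattice which is `r`-convex for some `r > 2`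
and `q`-concave for some `q < ∞`, and `X` is a Banach lattice which is `p`-convex for
some `p > 2` and isomorphic as a Banach space to a closed subspace of `Y`.  Then `X` is
`r`-convex.  (Banach lattices are represented as Köthe function spaces.) -/
theorem thm4_2 {α β : Type*} [MeasurableSpace α] [MeasurableSpace β]
    (μ : MeasureTheory.Measure α) (ν : MeasureTheory.Measure β)
    (Y : QuasiKothe β ν) (hYB : Banach Y)
    (r : ℝ) (hr : 2 < r) (hYr : PConvex Y.N r)
    (q : ℝ) (hq : 0 < q) (hYq : QConcave Y.N q)
    (X : QuasiKothe α μ) (hXB : Banach X)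
    (p : ℝ) (hp : 2 < p) (hXp : PConvex X.N p)
    (hemb : Embeds X.N Y.N) :
    PConvex X.N r := by
  obtain ⟨D, hDt, hD⟩ := key μ ν Y hYB r hr hYr q hq hYq X p hp hXp hemb
  obtain ⟨CY, hCY, hYr'⟩ := hYr
  refine ⟨D * (CY * D) + 1, ?_, final_bound Y r hr hYr' X hXB D hD⟩
  exact ENNReal.add_ne_top.2 ⟨ENNReal.mul_ne_top hDt (ENNReal.mul_ne_top hCY hDt), by simp⟩

end RIPaper
end
end

section
/- Suppose s, δ > 0 and 1 < p, q < ∞. Then there is a constant C = C(s,p,q,δ) such that the following holds: if X is a p-convex Köthe function space and Y is an s-convex, q-concave quasi-Köthe function space (with all convexity/concavity constants equal to one), and L : X → Y is a positive operator satisfying δ‖x‖_X ≤ ‖Lx‖_Y ≤ ‖x‖_X for all x ≥ 0, then for any pairwise disjoint x_1,…,x_n ≥ 0 in X, ‖Σ_{j=1}^n x_j‖_X ≤ C‖max_{1≤j≤n} Lx_j‖_Y. (Lemma 4.1: every cone-embedding in this situation is a strong cone-embedding.) -/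
/-!
Common definitions for formalizing results of Hernandez–Kalton,
"Subspaces of rearrangement-invariant spaces".

We model (quasi-)Köthe function spaces on a measure space `(α, μ)` by their
(possibly infinite-valued) admissible function quasinorm `N`, defined on all
functions `α → ℝ`, together with the usual axioms (a.e.-invariance, homogeneity,
solidity, a `p`-norm inequality for some `0 < p ≤ 1`, nondegeneracy and
completeness).  Rearrangement-invariant spaces on `[0,1]` or `[0,∞)` are such
spaces for Lebesgue measure restricted to the relevant interval, whose norm is
invariant under equimeasurability and normalized on `χ_{[0,1]}`.  Nonatomic
Polish measure spaces such as the Cantor group `(Δ, λ)` are modelled by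
`([0,1), Lebesgue)`, to which they are measure-isomorphic.  Abstract (separable,
order-continuous) Banach lattices are modelled by their Köthe function space
representations.
-/

open MeasureTheory Filter Set ENNReal

noncomputable section
namespace RIPaper

theorem aux_var (N : ℕ) (hN : 0 < N) (k : Fin N) : ∀ (n : ℕ) (a : Fin n → ℝ) (b : ℝ),
    ∑ σ : Fin n → Fin N, (b + ∑ j, a j * ((if σ j = k then 1 else 0) - (N:ℝ)⁻¹)) ^ 2
      ≤ (N:ℝ) ^ n * (b ^ 2 + (N:ℝ)⁻¹ * ∑ j, a j ^ 2) := by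
  have hN' : (N:ℝ) ≠ 0 := by positivity
  intro n
  induction n with
  | zero => intro a b; simp
  | succ n ih =>
    intro a b
    rw [← (Fin.consEquiv (fun _ : Fin (n+1) => Fin N)).sum_comp, Fintype.sum_prod_type]
    have h1 : ∀ i : Fin N, ∑ σ : Fin n → Fin N,
        (b + ∑ j, a j * ((if (Fin.consEquiv (fun _ : Fin (n+1) => Fin N)) (i, σ) j = k then 1 else 0) - (N:ℝ)⁻¹)) ^ 2
        ≤ (N:ℝ) ^ n * ((b + a 0 * ((if i = k then 1 else 0) - (N:ℝ)⁻¹)) ^ 2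
            + (N:ℝ)⁻¹ * ∑ j : Fin n, a j.succ ^ 2) := by
      intro i
      refine le_trans (le_of_eq ?_) (ih (fun j => a j.succ) _)
      refine Finset.sum_congr rfl fun σ _ => ?_
      simp [Fin.consEquiv, Fin.sum_univ_succ, add_assoc]
    refine (Finset.sum_le_sum fun i _ => h1 i).trans ?_
    rw [← Finset.mul_sum, Finset.sum_add_distrib, Fin.sum_univ_succ (n := n), pow_succ, mul_assoc]
    refine mul_le_mul_of_nonneg_left ?_ (by positivity)
    have h2 : ∑ i : Fin N, (b + a 0 * ((if i = k then 1 else 0) - (N:ℝ)⁻¹)) ^ 2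
        = N * b ^ 2 + a 0 ^ 2 * (1 - (N:ℝ)⁻¹) := by
      have : ∀ i : Fin N, (b + a 0 * ((if i = k then 1 else 0) - (N:ℝ)⁻¹)) ^ 2
          = (b - a 0 * (N:ℝ)⁻¹) ^ 2 + (if i = k then (2 * a 0 * (b - a 0 * (N:ℝ)⁻¹) + a 0 ^ 2) else 0) := by
        intro i; split_ifs <;> ring
      simp_rw [this]
      rw [Finset.sum_add_distrib]
      simp
      field_simp
      ring
    rw [h2]
    simp only [Finset.sum_const, Finset.card_univ, Fintype.card_fin, nsmul_eq_mul]
    have h3 : 0 ≤ a 0 ^ 2 * (N:ℝ)⁻¹ := by positivity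
    have h4 : (N:ℝ) * (N:ℝ)⁻¹ = 1 := by field_simp
    have : (N:ℝ) * (b ^ 2 + (N:ℝ)⁻¹ * (a 0 ^ 2 + ∑ i : Fin n, a i.succ ^ 2))
      = N * b^2 + a 0 ^ 2 + N * ((N:ℝ)⁻¹ * ∑ i : Fin n, a i.succ ^ 2) := by
      linear_combination a 0 ^ 2 * h4
    rw [this]
    linarith

theorem aux_point (q : ℝ) (hq : 1 < q) (N : ℕ) (hN : 0 < N) (k : Fin N) (n : ℕ) (a : Fin n → ℝ)
    (M : ℝ) (ha : ∀ j, 0 ≤ a j) (haM : ∀ j, a j ≤ M) (hM : 0 ≤ M) :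
    ∑ σ : Fin n → Fin N, (∑ j, (if σ j = k then 1 else 0) * a j) ^ q
      ≤ (N:ℝ) ^ n * (3 * (N:ℝ)⁻¹ * ∑ j, a j + (N:ℝ) ^ (q+1) * M) ^ q := by
  have hNr : (0:ℝ) < N := by positivity
  set S := ∑ j, a j with hS
  have hS0 : 0 ≤ S := Finset.sum_nonneg fun j _ => ha j
  have hT0 : ∀ σ : Fin n → Fin N, 0 ≤ ∑ j, (if σ j = k then 1 else 0) * a j := fun σ =>
    Finset.sum_nonneg fun j _ => by have := ha j; split_ifs <;> simp [this]
  have hTS : ∀ σ : Fin n → Fin N, ∑ j, (if σ j = k then 1 else 0) * a j ≤ S := fun σ =>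
    Finset.sum_le_sum fun j _ => by have := ha j; split_ifs <;> simp [this]
  have hcard : ∀ c : ℝ, ∑ σ : Fin n → Fin N, c = (N:ℝ)^n * c := by
    intro c; simp
  by_cases hc : (N:ℝ) ^ (q+1) * M ≤ S
  swap
  · rw [← hcard]
    refine Finset.sum_le_sum fun σ _ => Real.rpow_le_rpow (hT0 σ) ?_ (by linarith)
    have : 0 ≤ 3 * (N:ℝ)⁻¹ * S := by positivity
    linarith [hTS σ]
  rcases hS0.eq_or_lt with h0 | hSpos
  · have : ∀ σ : Fin n → Fin N, ∑ j, (if σ j = k then 1 else 0) * a j = 0 := fun σ =>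
      le_antisymm ((hTS σ).trans h0.symm.le) (hT0 σ)
    simp_rw [this]
    rw [Real.zero_rpow (by linarith)]
    simp only [Finset.sum_const_zero]
    positivity
  have hvar := aux_var N hN k n a 0
  have h1 : ∀ σ : Fin n → Fin N, (∑ j, (if σ j = k then 1 else 0) * a j) ^ q ≤
      (2 * (N:ℝ)⁻¹ * S) ^ q + (S ^ q * (N:ℝ)^2 / S^2) *
        (0 + ∑ j, a j * ((if σ j = k then 1 else 0) - (N:ℝ)⁻¹)) ^ 2 := by
    intro σ
    have e : (0 + ∑ j, a j * ((if σ j = k then 1 else 0) - (N:ℝ)⁻¹))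
        = (∑ j, (if σ j = k then 1 else 0) * a j) - (N:ℝ)⁻¹ * S := by
      rw [hS, Finset.mul_sum, ← Finset.sum_sub_distrib, zero_add]
      exact Finset.sum_congr rfl fun j _ => by ring
    rw [e]
    set T := ∑ j, (if σ j = k then 1 else 0) * a j
    by_cases hT : T ≤ 2 * (N:ℝ)⁻¹ * S
    · have := Real.rpow_le_rpow (hT0 σ) hT (by linarith : 0 ≤ q)
      have : 0 ≤ (S ^ q * (N:ℝ)^2 / S^2) * (T - (N:ℝ)⁻¹ * S) ^ 2 := by positivity
      linarith
    · push Not at hT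
      have h5 := Real.rpow_le_rpow (hT0 σ) (hTS σ) (by linarith : 0 ≤ q)
      have h6 : ((N:ℝ)⁻¹ * S)^2 ≤ (T - (N:ℝ)⁻¹ * S) ^ 2 :=
        pow_le_pow_left₀ (by positivity) (by linarith) 2
      have h7 : S ^ q = (S ^ q * (N:ℝ)^2 / S^2) * ((N:ℝ)⁻¹ * S)^2 := by
        field_simp
      have h8 : (S ^ q * (N:ℝ)^2 / S^2) * ((N:ℝ)⁻¹ * S)^2 ≤
        (S ^ q * (N:ℝ)^2 / S^2) * (T - (N:ℝ)⁻¹ * S) ^ 2 :=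
        mul_le_mul_of_nonneg_left h6 (by positivity)
      have : 0 ≤ (2 * (N:ℝ)⁻¹ * S) ^ q := by positivity
      linarith
  refine (Finset.sum_le_sum fun σ _ => h1 σ).trans ?_
  rw [Finset.sum_add_distrib, hcard, ← Finset.mul_sum]
  have hsq : ∑ j, a j ^ 2 ≤ M * S := by
    rw [hS, Finset.mul_sum]
    exact Finset.sum_le_sum fun j _ => by nlinarith [ha j, haM j]
  have hMS : M ≤ ((N:ℝ) ^ (q+1))⁻¹ * S := by
    rw [inv_mul_eq_div, le_div_iff₀ (by positivity)]; linarith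
  have hsq2 : ∑ j, a j ^ 2 ≤ ((N:ℝ) ^ (q+1))⁻¹ * S * S :=
    hsq.trans (mul_le_mul_of_nonneg_right hMS hS0)
  have h9 : (S ^ q * (N:ℝ)^2 / S^2) * ∑ σ : Fin n → Fin N,
        (0 + ∑ j, a j * ((if σ j = k then 1 else 0) - (N:ℝ)⁻¹)) ^ 2 ≤
      (N:ℝ)^n * ((N:ℝ)⁻¹ * S) ^ q := by
    calc _ ≤ (S ^ q * (N:ℝ)^2 / S^2) * ((N:ℝ) ^ n * (0 ^ 2 + (N:ℝ)⁻¹ * (((N:ℝ) ^ (q+1))⁻¹ * S * S))) := by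
          refine mul_le_mul_of_nonneg_left (hvar.trans ?_) (by positivity)
          gcongr
      _ = _ := by
          rw [Real.mul_rpow (by positivity) hS0, Real.inv_rpow hNr.le, Real.rpow_add hNr, Real.rpow_one]
          field_simp
          simp
  have h10 : (2 * (N:ℝ)⁻¹ * S) ^ q + ((N:ℝ)⁻¹ * S) ^ q ≤ (3 * (N:ℝ)⁻¹ * S) ^ q := by
    have := Real.add_rpow_le_rpow_add (a := 2 * (N:ℝ)⁻¹ * S) (b := (N:ℝ)⁻¹ * S) (by positivity) (by positivity) hq.le
    refine this.trans (le_of_eq ?_)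
    congr 1; ring
  have h11 : (3 * (N:ℝ)⁻¹ * S) ^ q ≤ (3 * (N:ℝ)⁻¹ * S + (N:ℝ) ^ (q+1) * M) ^ q :=
    Real.rpow_le_rpow (by positivity) (by have : 0 ≤ (N:ℝ) ^ (q+1) * M := by positivity
                                          linarith) (by linarith)
  have h12 := mul_le_mul_of_nonneg_left (h10.trans h11) (by positivity : (0:ℝ) ≤ (N:ℝ)^n)
  rw [mul_add] at h12
  linarith


theorem pconv_fintype {α : Type*} [MeasurableSpace α] {N : (α → ℝ) → ℝ≥0∞} {p : ℝ} (h : PConvexC N p 1) {ι : Type*} [Fintype ι]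
    (f : ι → α → ℝ) :
    N (fun t => (∑ i, |f i t| ^ p) ^ p⁻¹) ≤ (∑ i, N (f i) ^ p) ^ p⁻¹ := by
  have e := (Fintype.equivFin ι).symm
  have := h _ (fun i => f (e i))
  rw [one_mul] at this
  rw [← e.sum_comp (fun i => N (f i) ^ p)]
  have h2 : ∀ t, ∑ i, |f (e i) t| ^ p = ∑ i, |f i t| ^ p := fun t =>
    e.sum_comp (fun i => |f i t| ^ p)
  simpa only [h2] using this

theorem qconc_fintype {α : Type*} [MeasurableSpace α] {N : (α → ℝ) → ℝ≥0∞} {p : ℝ} (h : QConcaveC N p 1) {ι : Type*} [Fintype ι]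
    (f : ι → α → ℝ) :
    (∑ i, N (f i) ^ p) ^ p⁻¹ ≤ N (fun t => (∑ i, |f i t| ^ p) ^ p⁻¹) := by
  have e := (Fintype.equivFin ι).symm
  have := h _ (fun i => f (e i))
  rw [one_mul] at this
  rw [← e.sum_comp (fun i => N (f i) ^ p)]
  have h2 : ∀ t, ∑ i, |f (e i) t| ^ p = ∑ i, |f i t| ^ p := fun t =>
    e.sum_comp (fun i => |f i t| ^ p)
  simpa only [h2] using this

theorem quasi_tri {β : Type*} [MeasurableSpace β] {ν : Measure β} (Y : QuasiKothe β ν) {s : ℝ} (hs : 0 < s)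
    (h : PConvexC Y.N s 1) (f g : β → ℝ) :
    Y.N (fun t => f t + g t) ≤ ENNReal.ofReal (2 * 2 ^ s⁻¹) * (Y.N f + Y.N g) := by
  have h1 := pconv_fintype h (fun b : Bool => if b then f else g)
  simp only [Fintype.sum_bool, if_true, Bool.false_eq_true, if_false] at h1
  have h2 : Y.N (fun t => f t + g t) ≤ Y.N (fun t => 2 * (|f t| ^ s + |g t| ^ s) ^ s⁻¹) := by
    refine Y.solid (Eventually.of_forall fun t => ?_)
    have hf : |f t| ≤ (|f t| ^ s + |g t| ^ s) ^ s⁻¹ := by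
      rw [Real.le_rpow_inv_iff_of_pos (by positivity) (by positivity) hs]
      have : 0 ≤ |g t| ^ s := by positivity
      linarith
    have hg : |g t| ≤ (|f t| ^ s + |g t| ^ s) ^ s⁻¹ := by
      rw [Real.le_rpow_inv_iff_of_pos (by positivity) (by positivity) hs]
      have : 0 ≤ |f t| ^ s := by positivity
      linarith
    rw [abs_of_nonneg (a := 2 * _) (by positivity)]
    linarith [abs_add_le (f t) (g t)]
  rw [Y.smul_eq] at h2
  have h3 : (Y.N f ^ s + Y.N g ^ s) ^ s⁻¹ ≤ ENNReal.ofReal (2 ^ s⁻¹) * (Y.N f + Y.N g) := by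
    rw [← ENNReal.ofReal_rpow_of_pos (by norm_num)]
    have : Y.N f ^ s + Y.N g ^ s ≤ 2 * (Y.N f + Y.N g) ^ s := by
      rw [two_mul]
      gcongr <;> simp
    calc _ ≤ (2 * (Y.N f + Y.N g) ^ s) ^ s⁻¹ := by gcongr
      _ = _ := by
        rw [ENNReal.mul_rpow_of_nonneg _ _ (by positivity), ENNReal.rpow_rpow_inv hs.ne']
        simp
  refine h2.trans ?_
  rw [ENNReal.ofReal_mul (by norm_num), mul_assoc, abs_of_pos (by norm_num : (0:ℝ) < 2)]
  gcongr
  exact h1.trans h3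

theorem rpow_sum_le_sum {ι : Type*} (t : Finset ι) (f : ι → ℝ≥0∞) {r : ℝ} (h0 : 0 < r) (h1 : r ≤ 1) :
    (∑ i ∈ t, f i) ^ r ≤ ∑ i ∈ t, f i ^ r := by
  classical
  induction t using Finset.induction_on with
  | empty => simp [h0]
  | insert a t ha ih =>
    rw [Finset.sum_insert ha, Finset.sum_insert ha]
    exact (ENNReal.rpow_add_le_add_rpow _ _ h0.le h1).trans (by gcongr)

theorem pow_change {p q : ℝ} (hp : 1 < p) (hq : 1 < q) (N : ℕ) (A : ℝ≥0∞)
    (b : Fin N → ℝ≥0∞) (h : A ^ p ≤ ∑ k, b k ^ p) :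
    A ^ q ≤ (N:ℝ≥0∞) ^ (q / min p q - 1) * ∑ k, b k ^ q := by
  have hA : A ^ q = (A ^ p) ^ (q / p) := by
    rw [← ENNReal.rpow_mul]; congr 1; field_simp
  have hb : ∀ k, b k ^ q = (b k ^ p) ^ (q / p) := fun k => by
    rw [← ENNReal.rpow_mul]; congr 1; field_simp
  have h' : A ^ q ≤ (∑ k, b k ^ p) ^ (q / p) := by
    rw [hA]; gcongr
  simp_rw [hb]
  rcases le_total p q with hpq | hpq
  · rw [min_eq_left hpq]
    have := ENNReal.rpow_sum_le_const_mul_sum_rpow Finset.univ (fun k => b k ^ p) (p := q / p)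
      ((one_le_div (by linarith)).2 hpq)
    simp only [Finset.card_univ, Fintype.card_fin] at this
    exact h'.trans this
  · rw [min_eq_right hpq, div_self (by linarith), sub_self, ENNReal.rpow_zero, one_mul]
    exact h'.trans (rpow_sum_le_sum _ _ (div_pos (by linarith) (by linarith))
      ((div_le_one (by linarith)).2 hpq))

theorem key_s17 {α β : Type*} [MeasurableSpace α] [MeasurableSpace β] {δ p q : ℝ} (hδ : 0 < δ) (hp : 1 < p) (hq : 1 < q)
    {μ : Measure α} {ν : Measure β} (X : QuasiKothe α μ) (Y : QuasiKothe β ν)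
    (hX : PConvexC X.N p 1) (hY : QConcaveC Y.N q 1) (L : (α → ℝ) →ₗ[ℝ] (β → ℝ))
    (hL : ∀ f : α → ℝ, (∀ᵐ t ∂μ, 0 ≤ f t) → ∀ᵐ t ∂ν, 0 ≤ L f t)
    (hLd : ∀ f : α → ℝ, (∀ᵐ t ∂μ, 0 ≤ f t) → ENNReal.ofReal δ * X.N f ≤ Y.N (L f))
    (n : ℕ) (x : Fin n → α → ℝ) (hx : ∀ j, ∀ᵐ t ∂μ, 0 ≤ x j t)
    (hd : ∀ j k, j ≠ k → ∀ᵐ t ∂μ, x j t * x k t = 0) (N : ℕ) (hN : 0 < N) :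
    ENNReal.ofReal δ * X.N (fun t => ∑ j, x j t) ≤ (N:ℝ≥0∞) ^ (min p q)⁻¹ *
      Y.N (fun t => 3 * (N:ℝ)⁻¹ * (∑ j, L (x j) t) + (N:ℝ) ^ (q+1) * (⨆ j, L (x j) t)) := by
  have hNr : (0:ℝ) < N := by positivity
  have hr : 0 < min p q := lt_min (by linarith) (by linarith)
  set A := X.N (fun t => ∑ j, x j t)
  set G : β → ℝ := fun t => 3 * (N:ℝ)⁻¹ * (∑ j, L (x j) t) + (N:ℝ) ^ (q+1) * (⨆ j, L (x j) t) with hG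
  have hx' : ∀ᵐ t ∂μ, ∀ j, 0 ≤ x j t := ae_all_iff.2 hx
  have hd' : ∀ᵐ t ∂μ, ∀ j k, j ≠ k → x j t * x k t = 0 :=
    ae_all_iff.2 fun j => ae_all_iff.2 fun k => by
      by_cases h : j = k
      · exact Eventually.of_forall fun t h' => absurd h h'
      · filter_upwards [hd j k h] with t ht _ using ht
  have hy' : ∀ᵐ t ∂ν, ∀ j, 0 ≤ L (x j) t := ae_all_iff.2 fun j => hL _ (hx j)
  let F : (Fin n → Fin N) → Fin N → α → ℝ := fun σ k =>
    ∑ j, (if σ j = k then (1:ℝ) else 0) • x j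
  have hFt : ∀ σ k t, F σ k t = ∑ j, (if σ j = k then (1:ℝ) else 0) * x j t := by
    intro σ k t; simp only [F, Finset.sum_apply, Pi.smul_apply, smul_eq_mul]
  have hLF : ∀ σ k t, L (F σ k) t = ∑ j, (if σ j = k then (1:ℝ) else 0) * L (x j) t := by
    intro σ k t; simp only [F, map_sum, map_smul, Finset.sum_apply, Pi.smul_apply, smul_eq_mul]
  have hF0 : ∀ σ k, ∀ᵐ t ∂μ, 0 ≤ F σ k t := by
    intro σ k
    filter_upwards [hx'] with t ht
    rw [hFt]
    exact Finset.sum_nonneg fun j _ => mul_nonneg (by split_ifs <;> norm_num) (ht j)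
  -- p-convexity for each colouring
  have h1 : ∀ σ, A ^ p ≤ ∑ k, X.N (F σ k) ^ p := by
    intro σ
    have h := pconv_fintype hX (F σ)
    have e : A ≤ X.N (fun t => (∑ k, |F σ k t| ^ p) ^ p⁻¹) := by
      refine X.solid ?_
      filter_upwards [hx', hd'] with t ht hdt
      rw [abs_of_nonneg (Finset.sum_nonneg fun j _ => ht j), abs_of_nonneg (by positivity)]
      by_cases hz : ∀ j, x j t = 0
      · simp only [hz, Finset.sum_const_zero]; positivity
      push Not at hz
      obtain ⟨j0, hj0⟩ := hz
      have hz' : ∀ j, j ≠ j0 → x j t = 0 := fun j hj =>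
        (mul_eq_zero.1 (hdt j j0 hj)).resolve_right hj0
      rw [Finset.sum_eq_single j0 (fun j _ hj => hz' j hj) (by simp)]
      rw [Real.le_rpow_inv_iff_of_pos (ht j0) (by positivity) (by linarith)]
      have : F σ (σ j0) t = x j0 t := by
        rw [hFt, Finset.sum_eq_single j0 (fun j _ hj => by rw [hz' j hj, mul_zero]) (by simp)]
        simp
      calc x j0 t ^ p = |F σ (σ j0) t| ^ p := by rw [this, abs_of_nonneg (ht j0)]
        _ ≤ _ := Finset.single_le_sum (f := fun k => |F σ k t| ^ p)
            (fun k _ => by positivity) (Finset.mem_univ _)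
    exact (ENNReal.le_rpow_inv_iff (by linarith)).1 (e.trans h)
  have h2 : (N:ℝ≥0∞) ^ n * A ^ q ≤ (N:ℝ≥0∞) ^ (q / min p q - 1) *
      ∑ σ : Fin n → Fin N, ∑ k, X.N (F σ k) ^ q := by
    rw [Finset.mul_sum]
    have := Finset.sum_le_sum fun σ (_ : σ ∈ (Finset.univ : Finset (Fin n → Fin N))) =>
      pow_change hp hq N A _ (h1 σ)
    simpa using this
  -- q-concavity
  have h3 : ∑ σ : Fin n → Fin N, ∑ k, Y.N (L (F σ k)) ^ q ≤ (N:ℝ≥0∞) * (N:ℝ≥0∞) ^ n * Y.N G ^ q := by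
    have h := qconc_fintype hY (fun i : (Fin n → Fin N) × Fin N => L (F i.1 i.2))
    simp only [Fintype.sum_prod_type] at h
    have e : Y.N (fun t => (∑ σ : Fin n → Fin N, ∑ k, |L (F σ k) t| ^ q) ^ q⁻¹) ≤
        Y.N (fun t => ((N:ℝ) * (N:ℝ) ^ n) ^ q⁻¹ * G t) := by
      refine Y.solid ?_
      filter_upwards [hy'] with t ht
      have hM : 0 ≤ ⨆ j, L (x j) t := Real.iSup_nonneg ht
      have hjM : ∀ j, L (x j) t ≤ ⨆ j, L (x j) t := fun j =>
        le_ciSup (f := fun j => L (x j) t) (Set.finite_range _).bddAbove j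
      have hS : 0 ≤ ∑ j, L (x j) t := Finset.sum_nonneg fun j _ => ht j
      have hG0 : 0 ≤ G t := by simp only [hG]; positivity
      rw [abs_of_nonneg (by positivity), abs_of_nonneg (by positivity)]
      have : (∑ σ : Fin n → Fin N, ∑ k, |L (F σ k) t| ^ q) ≤ (N:ℝ) * (N:ℝ) ^ n * G t ^ q := by
        rw [Finset.sum_comm]
        calc _ ≤ ∑ k : Fin N, (N:ℝ) ^ n * G t ^ q := by
              refine Finset.sum_le_sum fun k _ => ?_
              refine le_trans (le_of_eq ?_) (aux_point q hq N hN k n (fun j => L (x j) t) _ ht hjM hM)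
              refine Finset.sum_congr rfl fun σ _ => ?_
              rw [hLF, abs_of_nonneg]
              exact Finset.sum_nonneg fun j _ => mul_nonneg (by split_ifs <;> norm_num) (ht j)
          _ = _ := by simp [mul_assoc]
      calc _ ≤ ((N:ℝ) * (N:ℝ) ^ n * G t ^ q) ^ q⁻¹ :=
            Real.rpow_le_rpow (by positivity) this (by positivity)
        _ = _ := by
          rw [Real.mul_rpow (by positivity) (by positivity), Real.rpow_rpow_inv hG0 (by linarith)]
    rw [Y.smul_eq, abs_of_nonneg (by positivity)] at e
    have h' := h.trans e
    rw [ENNReal.rpow_inv_le_iff (by linarith), ENNReal.mul_rpow_of_nonneg _ _ (by linarith),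
      ← ENNReal.ofReal_rpow_of_pos (by positivity), ENNReal.rpow_inv_rpow (by linarith),
      ENNReal.ofReal_mul hNr.le, ENNReal.ofReal_pow hNr.le, ENNReal.ofReal_natCast] at h'
    exact h'
  have h4 : ENNReal.ofReal δ ^ q * ∑ σ : Fin n → Fin N, ∑ k, X.N (F σ k) ^ q ≤
      ∑ σ : Fin n → Fin N, ∑ k, Y.N (L (F σ k)) ^ q := by
    rw [Finset.mul_sum]
    refine Finset.sum_le_sum fun σ _ => ?_
    rw [Finset.mul_sum]
    refine Finset.sum_le_sum fun k _ => ?_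
    rw [← ENNReal.mul_rpow_of_nonneg _ _ (by linarith)]
    exact ENNReal.rpow_le_rpow (hLd _ (hF0 σ k)) (by linarith)
  have hN0 : (N:ℝ≥0∞) ≠ 0 := by exact_mod_cast hN.ne'
  have hNt : (N:ℝ≥0∞) ≠ ⊤ := ENNReal.natCast_ne_top N
  have h5 : (N:ℝ≥0∞) ^ n * (ENNReal.ofReal δ * A) ^ q ≤
      (N:ℝ≥0∞) ^ n * ((N:ℝ≥0∞) ^ (min p q)⁻¹ * Y.N G) ^ q := by
    rw [ENNReal.mul_rpow_of_nonneg _ _ (by linarith), ENNReal.mul_rpow_of_nonneg _ _ (by linarith)]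
    calc _ = ENNReal.ofReal δ ^ q * ((N:ℝ≥0∞) ^ n * A ^ q) := by ring
      _ ≤ ENNReal.ofReal δ ^ q * ((N:ℝ≥0∞) ^ (q / min p q - 1) *
          ∑ σ : Fin n → Fin N, ∑ k, X.N (F σ k) ^ q) := by gcongr
      _ = (N:ℝ≥0∞) ^ (q / min p q - 1) * (ENNReal.ofReal δ ^ q *
          ∑ σ : Fin n → Fin N, ∑ k, X.N (F σ k) ^ q) := by ring
      _ ≤ (N:ℝ≥0∞) ^ (q / min p q - 1) * ((N:ℝ≥0∞) * (N:ℝ≥0∞) ^ n * Y.N G ^ q) := by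
          exact mul_le_mul_right (h4.trans h3) _
      _ = (N:ℝ≥0∞) ^ n * (((N:ℝ≥0∞) ^ (q / min p q - 1) * (N:ℝ≥0∞)) * Y.N G ^ q) := by ring
      _ = _ := by
          congr 2
          rw [← ENNReal.rpow_mul]
          nth_rewrite 2 [← ENNReal.rpow_one (N:ℝ≥0∞)]
          rw [← ENNReal.rpow_add _ _ hN0 hNt]
          congr 1
          field_simp
          ring
  have h6 := (ENNReal.mul_le_mul_iff_right (pow_ne_zero n hN0) (ENNReal.pow_ne_top hNt)).1 h5
  exact (ENNReal.rpow_le_rpow_iff (by linarith)).1 h6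

/-- **Lemma 4.1.** Suppose `s, δ > 0` and `1 < p, q < ∞`.  Then there is a constant
`C = C(s, p, q, δ)` such that: if `X` is a `p`-convex Köthe function space, `Y` is an
`s`-convex `q`-concave quasi-Köthe function space (all convexity and concavity constants
equal to one), and `L : X → Y` is a positive operator with `δ ‖x‖_X ≤ ‖Lx‖_Y ≤ ‖x‖_X`
for `x ≥ 0`, then for pairwise disjoint `x₁, …, xₙ ≥ 0` in `X`,
`‖∑ xⱼ‖_X ≤ C ‖max_j L xⱼ‖_Y`. -/
theorem lem4_1 (s δ p q : ℝ) (hs : 0 < s) (hδ : 0 < δ) (hp : 1 < p) (hq : 1 < q) :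
    ∃ C : ℝ≥0∞, C ≠ ⊤ ∧
      ∀ (α β : Type) [MeasurableSpace α] [MeasurableSpace β]
        (μ : MeasureTheory.Measure α) (ν : MeasureTheory.Measure β)
        (X : QuasiKothe α μ) (Y : QuasiKothe β ν),
        Banach X → PConvexC X.N p 1 →
        PConvexC Y.N s 1 → QConcaveC Y.N q 1 →
        ∀ L : (α → ℝ) →ₗ[ℝ] (β → ℝ),
          (∀ f : α → ℝ, (∀ᵐ t ∂μ, 0 ≤ f t) → ∀ᵐ t ∂ν, 0 ≤ L f t) →
          (∀ f : α → ℝ, (∀ᵐ t ∂μ, 0 ≤ f t) →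
            ENNReal.ofReal δ * X.N f ≤ Y.N (L f) ∧ Y.N (L f) ≤ X.N f) →
          ∀ (n : ℕ) (x : Fin n → α → ℝ),
            (∀ j, ∀ᵐ t ∂μ, 0 ≤ x j t) →
            (∀ j k, j ≠ k → ∀ᵐ t ∂μ, x j t * x k t = 0) →
            X.N (fun t => ∑ j, x j t) ≤ C * Y.N (fun t => ⨆ j, L (x j) t) := by
  set r := min p q with hrdef
  have hr : 1 < r := lt_min hp hq
  set K : ℝ := 2 * 2 ^ s⁻¹ with hK
  have hKpos : 0 < K := by positivity
  obtain ⟨N, hN, hNK⟩ : ∃ N : ℕ, 0 < N ∧ 6 * K / δ ≤ (N:ℝ) ^ (1 - r⁻¹) := by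
    have h1 : 0 < 1 - r⁻¹ := by
      have := inv_lt_one_of_one_lt₀ hr
      linarith
    have h := ((tendsto_rpow_atTop h1).comp tendsto_natCast_atTop_atTop).eventually_ge_atTop
      (6 * K / δ)
    obtain ⟨N, h2, h3⟩ := (h.and (eventually_gt_atTop 0)).exists
    exact ⟨N, h3, h2⟩
  have hNr : (0:ℝ) < N := by positivity
  set D : ℝ := (N:ℝ) ^ r⁻¹ * (K * (N:ℝ) ^ (q+1)) with hD
  have hDpos : 0 < D := by positivity
  refine ⟨ENNReal.ofReal (2 * D / δ), ENNReal.ofReal_ne_top, ?_⟩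
  intro α β _ _ μ ν X Y _ hXp hYs hYq L hL hLd n x hx hd
  have hy' : ∀ᵐ t ∂ν, ∀ j, 0 ≤ L (x j) t := ae_all_iff.2 fun j => hL _ (hx j)
  have hx' : ∀ᵐ t ∂μ, 0 ≤ ∑ j, x j t := by
    filter_upwards [ae_all_iff.2 hx] with t ht
    exact Finset.sum_nonneg fun j _ => ht j
  have hLS : L (fun t => ∑ j, x j t) = fun t => ∑ j, L (x j) t := by
    have : (fun t => ∑ j, x j t) = ∑ j, x j := by ext t; simp
    rw [this, map_sum]; ext t; simp
  obtain ⟨hlow, hup⟩ := hLd _ hx'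
  rw [hLS] at hlow hup
  set A := X.N (fun t => ∑ j, x j t) with hA
  set S : β → ℝ := fun t => ∑ j, L (x j) t with hS
  set M : β → ℝ := fun t => ⨆ j, L (x j) t with hM
  by_cases hAt : A = ⊤
  · have h1 : Y.N S ≤ Y.N (fun t => (n:ℝ) * M t) := by
      refine Y.solid ?_
      filter_upwards [hy'] with t ht
      have hM0 : 0 ≤ M t := Real.iSup_nonneg ht
      have hjM : ∀ j, L (x j) t ≤ M t := fun j =>
        le_ciSup (f := fun j => L (x j) t) (Set.finite_range _).bddAbove j
      rw [abs_of_nonneg (Finset.sum_nonneg fun j _ => ht j), abs_of_nonneg (by positivity)]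
      calc _ ≤ ∑ j : Fin n, M t := Finset.sum_le_sum fun j _ => hjM j
        _ = _ := by simp
    rw [Y.smul_eq] at h1
    have h2 : Y.N M = ⊤ := by
      by_contra hne
      have h3 := hlow.trans h1
      rw [hAt, ENNReal.mul_top (by simpa using hδ)] at h3
      exact (ENNReal.mul_ne_top ENNReal.ofReal_ne_top hne) (top_le_iff.1 h3)
    rw [h2, ENNReal.mul_top]
    · exact le_top
    · have : 0 < 2 * D / δ := by positivity
      simpa using this
  have hk := key_s17 hδ hp hq X Y hXp hYq L hL (fun f hf => (hLd f hf).1) n x hx hd N hN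
  have ht := quasi_tri Y hs hYs (fun t => 3 * (N:ℝ)⁻¹ * S t) (fun t => (N:ℝ) ^ (q+1) * M t)
  rw [Y.smul_eq, Y.smul_eq, abs_of_pos (by positivity), abs_of_pos (by positivity)] at ht
  have hNe : (N:ℝ≥0∞) ^ r⁻¹ = ENNReal.ofReal ((N:ℝ) ^ r⁻¹) := by
    rw [← ENNReal.ofReal_rpow_of_pos hNr, ENNReal.ofReal_natCast]
  by_cases hMt : Y.N M = ⊤
  · rw [hMt, ENNReal.mul_top]
    · exact le_top
    · have : 0 < 2 * D / δ := by positivity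
      simpa using this
  have hfin : ENNReal.ofReal δ * A ≤ ENNReal.ofReal ((N:ℝ) ^ r⁻¹) * (ENNReal.ofReal K *
      (ENNReal.ofReal (3 * (N:ℝ)⁻¹) * A + ENNReal.ofReal ((N:ℝ) ^ (q+1)) * Y.N M)) := by
    rw [hNe] at hk
    refine hk.trans ?_
    gcongr
    refine ht.trans ?_
    gcongr
  -- pass to reals
  obtain ⟨a, ha⟩ : ∃ a : ℝ, 0 ≤ a ∧ A = ENNReal.ofReal a :=
    ⟨A.toReal, ENNReal.toReal_nonneg, (ENNReal.ofReal_toReal hAt).symm⟩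
  obtain ⟨m, hm⟩ : ∃ m : ℝ, 0 ≤ m ∧ Y.N M = ENNReal.ofReal m :=
    ⟨(Y.N M).toReal, ENNReal.toReal_nonneg, (ENNReal.ofReal_toReal hMt).symm⟩
  obtain ⟨ha0, ha⟩ := ha
  obtain ⟨hm0, hm⟩ := hm
  rw [ha, hm] at hfin
  rw [ha, hm, ← ENNReal.ofReal_mul (by positivity)]
  rw [← ENNReal.ofReal_mul (by positivity), ← ENNReal.ofReal_mul (by positivity),
    ← ENNReal.ofReal_mul (by positivity), ← ENNReal.ofReal_add (by positivity) (by positivity),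
    ← ENNReal.ofReal_mul (by positivity), ← ENNReal.ofReal_mul (by positivity),
    ENNReal.ofReal_le_ofReal_iff (by positivity)] at hfin
  refine ENNReal.ofReal_le_ofReal ?_
  have h1 : (N:ℝ) ^ r⁻¹ * K * (3 * (N:ℝ)⁻¹) ≤ δ / 2 := by
    have e : (N:ℝ) ^ (1 - r⁻¹) * (N:ℝ) ^ r⁻¹ = N := by
      rw [← Real.rpow_add hNr]; simp
    have h2 : 6 * K ≤ (N:ℝ) ^ (1 - r⁻¹) * δ := (div_le_iff₀ hδ).1 hNK
    have h3 : 6 * K * (N:ℝ) ^ r⁻¹ ≤ N * δ := by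
      calc _ ≤ (N:ℝ) ^ (1 - r⁻¹) * δ * (N:ℝ) ^ r⁻¹ :=
            mul_le_mul_of_nonneg_right h2 (by positivity)
        _ = ((N:ℝ) ^ (1 - r⁻¹) * (N:ℝ) ^ r⁻¹) * δ := by ring
        _ = _ := by rw [e]
    have : (N:ℝ) ^ r⁻¹ * K * (3 * (N:ℝ)⁻¹) = (6 * K * (N:ℝ) ^ r⁻¹) / N / 2 := by
      field_simp; ring
    rw [this]
    gcongr
    rw [div_le_iff₀ hNr]; linarith
  have h2 := mul_le_mul_of_nonneg_right h1 ha0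
  have h3 : δ * a ≤ 2 * D * m := by
    have e : (N:ℝ) ^ r⁻¹ * (K * (3 * (N:ℝ)⁻¹ * a + (N:ℝ) ^ (q+1) * m)) =
      (N:ℝ) ^ r⁻¹ * K * (3 * (N:ℝ)⁻¹) * a + D * m := by rw [hD]; ring
    rw [e] at hfin
    linarith
  rw [div_mul_eq_mul_div, le_div_iff₀ hδ]
  linarith

end RIPaper
end
end
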